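/- Assume F satisfies (H1), (H2') and (H3) with l = 0. Then for every (p_x,p_y) ∈ ℝⁿ×ℝ there exists exactly one constant λ ∈ ℝ such that the cell problem v_t + F(x,y,t, p_x + D_x v, p_y + D_y v) = λ on ℝⁿ×ℝ×ℝ admits both a bounded space-time periodic usc viscosity subsolution and a bounded space-time periodic lsc viscosity supersolution; denoting this constant by F̄(p_x,p_y), one has min_{x,y,t} F(x,y,t,p_x,p_y) ≤ F̄(p_x,p_y) ≤ max_{x,y,t} F(x,y,t,p_x,p_y). -/

import Mathlib

open MeasureTheory Topology Filter
open scoped RealInnerProductSpace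

noncomputable section

/-- Euclidean space ℝⁿ. -/
abbrev Euc (n : ℕ) := EuclideanSpace ℝ (Fin n)

/-- Hamiltonians G = G(x, y, t, p_x, p_y). -/
abbrev Ham (n : ℕ) := Euc n → ℝ → ℝ → Euc n → ℝ → ℝ

/-- The space of points (x, y, t) ∈ ℝⁿ×ℝ×ℝ. -/
abbrev Dom (n : ℕ) := Euc n × ℝ × ℝ

/-- The space of points ξ = (x, y, t, p_x, p_y). -/
abbrev Xi (n : ℕ) := Euc n × ℝ × ℝ × Euc n × ℝ

/-- The space of points (x, t) ∈ ℝⁿ×ℝ. -/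
abbrev Dom2 (n : ℕ) := Euc n × ℝ

/-- The integer vector k viewed as a point of ℝⁿ. -/
def intVec {n : ℕ} (k : Fin n → ℤ) : Euc n := WithLp.toLp 2 fun i => (k i : ℝ)

/-- ∂φ/∂t for φ = φ(x,y,t). -/
def pdT {n : ℕ} (φ : Dom n → ℝ) (z : Dom n) : ℝ := fderiv ℝ φ z (0, 0, 1)

/-- ∂φ/∂y for φ = φ(x,y,t). -/
def pdY {n : ℕ} (φ : Dom n → ℝ) (z : Dom n) : ℝ := fderiv ℝ φ z (0, 1, 0)

/-- D_x φ for φ = φ(x,y,t). -/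
def pdX {n : ℕ} (φ : Dom n → ℝ) (z : Dom n) : Euc n :=
  WithLp.toLp 2 fun i => fderiv ℝ φ z (EuclideanSpace.single i 1, 0, 0)

/-- ∂φ/∂t for φ = φ(x,t). -/
def pdT2 {n : ℕ} (φ : Dom2 n → ℝ) (z : Dom2 n) : ℝ := fderiv ℝ φ z (0, 1)

/-- D_x φ for φ = φ(x,t). -/
def pdX2 {n : ℕ} (φ : Dom2 n → ℝ) (z : Dom2 n) : Euc n :=
  WithLp.toLp 2 fun i => fderiv ℝ φ z (EuclideanSpace.single i 1, 0)

/-- Viscosity subsolution of `w_t + G(x,y,t,D_x w,D_y w) + α w = λ` on ℝⁿ×ℝ×ℝ. -/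
def ViscSub {n : ℕ} (G : Ham n) (α lam : ℝ) (u : Dom n → ℝ) : Prop :=
  UpperSemicontinuous u ∧
  ∀ φ : Dom n → ℝ, ContDiff ℝ 1 φ → ∀ z : Dom n,
    IsLocalMax (fun w => u w - φ w) z →
    pdT φ z + G z.1 z.2.1 z.2.2 (pdX φ z) (pdY φ z) + α * u z ≤ lam

/-- Viscosity supersolution of `w_t + G(x,y,t,D_x w,D_y w) + α w = λ` on ℝⁿ×ℝ×ℝ. -/
def ViscSuper {n : ℕ} (G : Ham n) (α lam : ℝ) (u : Dom n → ℝ) : Prop :=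
  LowerSemicontinuous u ∧
  ∀ φ : Dom n → ℝ, ContDiff ℝ 1 φ → ∀ z : Dom n,
    IsLocalMin (fun w => u w - φ w) z →
    lam ≤ pdT φ z + G z.1 z.2.1 z.2.2 (pdX φ z) (pdY φ z) + α * u z

/-- Viscosity solution of `w_t + G(x,y,t,D_x w,D_y w) + α w = λ` on ℝⁿ×ℝ×ℝ. -/
def ViscSol {n : ℕ} (G : Ham n) (α lam : ℝ) (u : Dom n → ℝ) : Prop :=
  Continuous u ∧ ViscSub G α lam u ∧ ViscSuper G α lam u

/-- ℤⁿ-periodicity in x, 1-periodicity in y and t. -/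
def STPeriodic {n : ℕ} (u : Dom n → ℝ) : Prop :=
  (∀ (k : Fin n → ℤ) (x : Euc n) (y t : ℝ), u (x + intVec k, y, t) = u (x, y, t)) ∧
  (∀ x y t, u (x, y + 1, t) = u (x, y, t)) ∧
  (∀ x y t, u (x, y, t + 1) = u (x, y, t))

/-- Boundedness of a function on ℝⁿ×ℝ×ℝ. -/
def Bdd {n : ℕ} (u : Dom n → ℝ) : Prop := ∃ M, ∀ z, |u z| ≤ M

/-- (H1) : continuity and periodicity of the Hamiltonian. -/
def HypH1 {n : ℕ} (G : Ham n) : Prop :=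
  Continuous (fun ξ : Xi n => G ξ.1 ξ.2.1 ξ.2.2.1 ξ.2.2.2.1 ξ.2.2.2.2) ∧
  (∀ (k : Fin n → ℤ) x y t px py, G (x + intVec k) y t px py = G x y t px py) ∧
  (∀ x y t px py, G x (y + 1) t px py = G x y t px py) ∧
  (∀ x y t px py, G x y (t + 1) px py = G x y t px py)

/-- (H2) : coercivity in p_x at p_y = 0, with constants C₁, C₂ > 0. -/
def HypH2 {n : ℕ} (G : Ham n) (C₁ C₂ : ℝ) : Prop :=
  0 < C₁ ∧ 0 < C₂ ∧ ∀ x y t px, C₁ * ‖px‖ - C₂ ≤ G x y t px 0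

/-- (H2') : coercivity in p_x, locally uniformly in p_y. -/
def HypH2' {n : ℕ} (F : Ham n) : Prop :=
  ∀ R : ℝ, 0 < R → ∃ C₁ C₂ : ℝ, 0 < C₁ ∧ 0 < C₂ ∧
    ∀ x y t px py, |py| ≤ R → C₁ * ‖px‖ - C₂ ≤ F x y t px py

/-- (H3) : local Lipschitz continuity in (y,t,p_y) and a.e. bounds on the
partial derivatives ∂_y G, ∂_t G, ∂_{p_y} G. -/
def HypH3 {n : ℕ} (G : Ham n) (l C₃ C₄ C₅ : ℝ) : Prop :=
  0 ≤ C₃ ∧ 0 ≤ C₄ ∧ 0 ≤ C₅ ∧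
  (∀ (x px : Euc n), LocallyLipschitz (fun q : ℝ × ℝ × ℝ => G x q.1 q.2.1 px q.2.2)) ∧
  (∀ᵐ ξ ∂(volume : Measure (Xi n)),
    |deriv (fun y => G ξ.1 y ξ.2.2.1 ξ.2.2.2.1 ξ.2.2.2.2) ξ.2.1| ≤ C₃ * |ξ.2.2.2.2 + l| ∧
    |deriv (fun t => G ξ.1 ξ.2.1 t ξ.2.2.2.1 ξ.2.2.2.2) ξ.2.2.1| ≤
      C₄ * (1 + |ξ.2.2.2.2| + |G ξ.1 ξ.2.1 ξ.2.2.1 ξ.2.2.2.1 ξ.2.2.2.2|) ∧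
    |deriv (fun py => G ξ.1 ξ.2.1 ξ.2.2.1 ξ.2.2.2.1 py) ξ.2.2.2.2| ≤ C₅)

/-- λ is an ergodic constant : bounded usc subsolution and bounded lsc
supersolution of `w_t + G = λ` exist. -/
def ErgodicConst {n : ℕ} (G : Ham n) (lam : ℝ) : Prop :=
  (∃ u, Bdd u ∧ ViscSub G 0 lam u) ∧ (∃ v, Bdd v ∧ ViscSuper G 0 lam v)

/-- λ solves the cell problem at (p_x,p_y) : the equation
`v_t + F(x,y,t,p_x + D_x v, p_y + D_y v) = λ` has a bounded space-time periodic
usc subsolution and a bounded space-time periodic lsc supersolution. -/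
def CellOk {n : ℕ} (F : Ham n) (px : Euc n) (py lam : ℝ) : Prop :=
  (∃ u, Bdd u ∧ STPeriodic u ∧
    ViscSub (fun x y t qx qy => F x y t (px + qx) (py + qy)) 0 lam u) ∧
  (∃ v, Bdd v ∧ STPeriodic v ∧
    ViscSuper (fun x y t qx qy => F x y t (px + qx) (py + qy)) 0 lam v)

/-- Viscosity subsolution of `w_t + G(x,y,t,D_x w,D_y w) = 0` on ℝⁿ×ℝ×(0,∞). -/
def ViscSubPos {n : ℕ} (G : Ham n) (u : Dom n → ℝ) : Prop :=
  ∀ φ : Dom n → ℝ, ContDiff ℝ 1 φ → ∀ z : Dom n, 0 < z.2.2 →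
    IsLocalMax (fun w => u w - φ w) z →
    pdT φ z + G z.1 z.2.1 z.2.2 (pdX φ z) (pdY φ z) ≤ 0

/-- Viscosity supersolution of `w_t + G(x,y,t,D_x w,D_y w) = 0` on ℝⁿ×ℝ×(0,∞). -/
def ViscSuperPos {n : ℕ} (G : Ham n) (u : Dom n → ℝ) : Prop :=
  ∀ φ : Dom n → ℝ, ContDiff ℝ 1 φ → ∀ z : Dom n, 0 < z.2.2 →
    IsLocalMin (fun w => u w - φ w) z →
    0 ≤ pdT φ z + G z.1 z.2.1 z.2.2 (pdX φ z) (pdY φ z)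

/-- Bounded uniformly continuous (on every slab ℝⁿ×ℝ×[0,T]) viscosity solution of the
initial value problem `v_t + G(x,y,t,D_x v,D_y v) = 0` on ℝⁿ×ℝ×(0,∞), `v(x,y,0) = v₀(x,y)`. -/
def IVPSol {n : ℕ} (G : Ham n) (v₀ : Dom2 n → ℝ) (v : Dom n → ℝ) : Prop :=
  ContinuousOn v {z : Dom n | 0 ≤ z.2.2} ∧
  (∀ x y, v (x, y, 0) = v₀ (x, y)) ∧
  ViscSubPos G v ∧ ViscSuperPos G v ∧
  (∀ T : ℝ, 0 < T →
    (∃ M, ∀ z : Dom n, 0 ≤ z.2.2 → z.2.2 ≤ T → |v z| ≤ M) ∧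
    UniformContinuousOn v {z : Dom n | 0 ≤ z.2.2 ∧ z.2.2 ≤ T})

/-- Viscosity subsolution of the eikonal-type inequality `w_t + c|D_x w| - C ≤ 0` on ℝⁿ×ℝ. -/
def ViscSubEik {n : ℕ} (c C : ℝ) (u : Dom2 n → ℝ) : Prop :=
  UpperSemicontinuous u ∧
  ∀ φ : Dom2 n → ℝ, ContDiff ℝ 1 φ → ∀ z : Dom2 n,
    IsLocalMax (fun w => u w - φ w) z →
    pdT2 φ z + c * ‖pdX2 φ z‖ - C ≤ 0

set_option linter.unusedSectionVars false

/-! ## Basic calculus -/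

/-- The first order operator `φ_t + G(z, Dφ)`. -/
def hop {n : ℕ} (G : Ham n) (φ : Dom n → ℝ) (z : Dom n) : ℝ :=
  pdT φ z + G z.1 z.2.1 z.2.2 (pdX φ z) (pdY φ z)

/-- Joint continuity of a Hamiltonian. -/
def HCont {n : ℕ} (G : Ham n) : Prop :=
  Continuous (fun ξ : Xi n => G ξ.1 ξ.2.1 ξ.2.2.1 ξ.2.2.2.1 ξ.2.2.2.2)

lemma hop_congr {n : ℕ} (G : Ham n) {φ ψ : Dom n → ℝ} {z : Dom n}
    (h : fderiv ℝ φ z = fderiv ℝ ψ z) : hop G φ z = hop G ψ z := by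
  simp only [hop, pdT, pdX, pdY, h]

lemma hop_continuous {n : ℕ} {G : Ham n} (hG : HCont G) {φ : Dom n → ℝ}
    (hφ : ContDiff ℝ 1 φ) : Continuous (hop G φ) := by
  have hf : Continuous (fderiv ℝ φ) := hφ.continuous_fderiv (by norm_num)
  have h1 : Continuous (pdT φ) := by unfold pdT; fun_prop
  have h2 : Continuous (pdY φ) := by unfold pdY; fun_prop
  have h3 : Continuous (pdX φ) := by
    unfold pdX
    refine (PiLp.continuous_toLp 2 (fun _ : Fin n => ℝ)).comp ?_
    refine continuous_pi fun i => ?_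
    fun_prop
  unfold hop
  refine h1.add ?_
  exact hG.comp (continuous_fst.prodMk ((continuous_fst.comp continuous_snd).prodMk
    ((continuous_snd.comp continuous_snd).prodMk (h3.prodMk h2))))

lemma hop_eq {n : ℕ} (G : Ham n) {φ : Dom n → ℝ} {L : Dom n →L[ℝ] ℝ} {z : Dom n}
    (h : HasFDerivAt φ L z) (a : Euc n) (ha : ∀ v, L (v, 0, 0) = inner ℝ a v) :
    hop G φ z = L (0, 0, 1) + G z.1 z.2.1 z.2.2 a (L (0, 1, 0)) := by
  have : pdX φ z = a := by
    unfold pdX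
    ext i
    simp only [h.fderiv, ha, EuclideanSpace.inner_single_right]
    simp
  simp only [hop, this, pdT, pdY, h.fderiv]

/-- Quadratic bump. -/
def qf {n : ℕ} (z w : Dom n) : ℝ :=
  ‖w.1 - z.1‖ ^ 2 + (w.2.1 - z.2.1) ^ 2 + (w.2.2 - z.2.2) ^ 2

lemma qf_contDiff {n : ℕ} (z : Dom n) : ContDiff ℝ 1 (qf z) := by
  unfold qf
  refine ContDiff.add (ContDiff.add ?_ ?_) ?_
  · exact (contDiff_fst.sub contDiff_const).norm_sq ℝ
  · fun_prop
  · fun_prop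

lemma qf_self {n : ℕ} (z : Dom n) : qf z z = 0 := by simp [qf]

lemma qf_nonneg {n : ℕ} (z w : Dom n) : 0 ≤ qf z w := by unfold qf; positivity

lemma qf_dist {n : ℕ} (z w : Dom n) : dist w z ^ 2 ≤ qf z w := by
  have h1 : dist w z = max (dist w.1 z.1) (max (dist w.2.1 z.2.1) (dist w.2.2 z.2.2)) := rfl
  rw [h1, dist_eq_norm, Real.dist_eq, Real.dist_eq]
  unfold qf
  have := sq_nonneg ‖w.1 - z.1‖
  have := sq_nonneg (w.2.1 - z.2.1)
  have := sq_nonneg (w.2.2 - z.2.2)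
  rcases max_choice (‖w.1 - z.1‖) (max |w.2.1 - z.2.1| |w.2.2 - z.2.2|) with h | h
  · rw [h]; linarith
  · rw [h]
    rcases max_choice |w.2.1 - z.2.1| |w.2.2 - z.2.2| with h | h <;> rw [h, sq_abs] <;> linarith

lemma qf_fderiv {n : ℕ} (z : Dom n) : fderiv ℝ (qf z) z = 0 := by
  apply IsLocalMin.fderiv_eq_zero
  filter_upwards with w
  rw [qf_self]; exact qf_nonneg z w

/-! ## Symmetries of the notion of solution -/

/-- The Hamiltonian satisfied by `-u`. -/
def negH {n : ℕ} (G : Ham n) : Ham n := fun x y t p q => - G x y t (-p) (-q)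

lemma negH_cont {n : ℕ} {G : Ham n} (hG : HCont G) : HCont (negH G) := by
  unfold HCont negH
  refine Continuous.neg ?_
  refine hG.comp (f := fun ξ : Xi n => ((ξ.1, ξ.2.1, ξ.2.2.1, -ξ.2.2.2.1, -ξ.2.2.2.2) : Xi n)) ?_
  fun_prop

lemma negH_negH {n : ℕ} (G : Ham n) : negH (negH G) = G := by
  funext x y t p q; simp [negH]

lemma hop_neg {n : ℕ} (G : Ham n) (φ : Dom n → ℝ) (z : Dom n) :
    hop (negH G) (fun w => - φ w) z = - hop G φ z := by
  have h : fderiv ℝ (fun w => - φ w) z = - fderiv ℝ φ z := fderiv_fun_neg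
  have h3 : pdX (fun w => - φ w) z = - pdX φ z := by
    unfold pdX; ext i; simp [h]
  simp only [hop, negH, h3, pdT, pdY, h]
  simp; ring

lemma ViscSuper.neg {n : ℕ} {G : Ham n} {α lam : ℝ} {v : Dom n → ℝ}
    (h : ViscSuper G α lam v) : ViscSub (negH G) α (-lam) (fun z => - v z) := by
  refine ⟨?_, ?_⟩
  · intro z c hc
    have := h.1 z (-c) (by linarith)
    filter_upwards [this] with w hw using by linarith
  · intro φ hφ z hz
    have h2 := h.2 (fun w => - φ w) hφ.neg z (by
      filter_upwards [hz] with w hw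
      linarith)
    have h3 := hop_neg (negH G) φ z
    rw [negH_negH] at h3
    unfold hop at h3
    linarith

lemma ViscSub.neg {n : ℕ} {G : Ham n} {α lam : ℝ} {v : Dom n → ℝ}
    (h : ViscSub G α lam v) : ViscSuper (negH G) α (-lam) (fun z => - v z) := by
  refine ⟨?_, ?_⟩
  · intro z c hc
    have := h.1 z (-c) (by linarith)
    filter_upwards [this] with w hw using by linarith
  · intro φ hφ z hz
    have h2 := h.2 (fun w => - φ w) hφ.neg z (by
      filter_upwards [hz] with w hw
      linarith)
    have h3 := hop_neg (negH G) φ z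
    rw [negH_negH] at h3
    unfold hop at h3
    linarith

/-- Translation-invariance of a Hamiltonian. -/
def HShift {n : ℕ} (G : Ham n) (k : Dom n) : Prop :=
  ∀ x y t p q, G (x + k.1) (y + k.2.1) (t + k.2.2) p q = G x y t p q

lemma hop_shift {n : ℕ} {G : Ham n} {k : Dom n} (hk : HShift G k) (φ : Dom n → ℝ) (z : Dom n) :
    hop G (fun w => φ (w + k)) z = hop G φ (z + k) := by
  have h : fderiv ℝ (fun w => φ (w + k)) z = fderiv ℝ φ (z + k) := fderiv_comp_add_right k
  have := hk z.1 z.2.1 z.2.2 (pdX φ (z + k)) (pdY φ (z + k))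
  simp only [hop, pdT, pdX, pdY, h] at this ⊢
  rw [← this]; rfl

lemma ViscSub.shift {n : ℕ} {G : Ham n} {k : Dom n} (hk : HShift G k) {α lam : ℝ}
    {u : Dom n → ℝ} (h : ViscSub G α lam u) : ViscSub G α lam (fun z => u (z + k)) := by
  refine ⟨?_, ?_⟩
  · intro z c hc
    have h1 : Tendsto (fun w => w + k) (𝓝 z) (𝓝 (z + k)) := (continuous_add_const k).tendsto z
    exact h1.eventually (h.1 (z + k) c hc)
  · intro φ hφ z hz
    have h2 := h.2 (fun w => φ (w - k)) (by fun_prop) (z + k) (by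
      have h1 : Tendsto (fun w => w - k) (𝓝 (z + k)) (𝓝 z) := by
        have hc : Continuous (fun w : Dom n => w - k) := by fun_prop
        have := hc.tendsto (z + k)
        simpa using this
      filter_upwards [h1.eventually hz] with w hw
      simpa using hw)
    have h3 := hop_shift hk (fun w => φ (w - k)) z
    simp only [add_sub_cancel_right] at h3
    unfold hop at h3
    simp only
    rw [h3]; exact h2

/-! ## Half-relaxed limits -/

/-- Upper half-relaxed limit along a filter. -/
def hls {n : ℕ} {ι : Type*} (l : Filter ι) (u : ι → Dom n → ℝ) (z : Dom n) : ℝ :=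
  limsup (fun p : ι × Dom n => u p.1 p.2) (l ×ˢ 𝓝 z)

section hls
variable {n : ℕ} {ι : Type*} {l : Filter ι} [NeBot l] {u : ι → Dom n → ℝ} {B : ℝ}

lemma hls_bdd (hB : ∀ i z, |u i z| ≤ B) (z : Dom n) :
    (l ×ˢ 𝓝 z).IsBoundedUnder (· ≤ ·) (fun p : ι × Dom n => u p.1 p.2) :=
  ⟨B, by simp only [eventually_map]; exact .of_forall fun p => (abs_le.1 (hB _ _)).2⟩

lemma hls_cobdd (hB : ∀ i z, |u i z| ≤ B) (z : Dom n) :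
    (l ×ˢ 𝓝 z).IsCoboundedUnder (· ≤ ·) (fun p : ι × Dom n => u p.1 p.2) := by
  apply IsBoundedUnder.isCoboundedUnder_le
  exact ⟨-B, by simp only [eventually_map]; exact .of_forall fun p => (abs_le.1 (hB _ _)).1⟩

lemma hls_ev (hB : ∀ i z, |u i z| ≤ B) {z : Dom n} {c : ℝ} (h : hls l u z < c) :
    ∀ᶠ p in l ×ˢ 𝓝 z, u p.1 p.2 < c :=
  eventually_lt_of_limsup_lt h (hls_bdd hB z)

lemma hls_fr (hB : ∀ i z, |u i z| ≤ B) {z : Dom n} {c : ℝ} (h : c < hls l u z) :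
    ∃ᶠ p in l ×ˢ 𝓝 z, c < u p.1 p.2 :=
  frequently_lt_of_lt_limsup (hls_cobdd hB z) h

lemma hls_le (hB : ∀ i z, |u i z| ≤ B) {z : Dom n} {c : ℝ}
    (h : ∀ᶠ p in l ×ˢ 𝓝 z, u p.1 p.2 ≤ c) : hls l u z ≤ c :=
  limsup_le_of_le (hls_cobdd hB z) h

lemma hls_usc (hB : ∀ i z, |u i z| ≤ B) : UpperSemicontinuous (hls l u) := by
  intro z c hc
  obtain ⟨c', h1, h2⟩ := exists_between hc
  obtain ⟨pa, hpa, pb, hpb, hp⟩ := eventually_prod_iff.1 (hls_ev hB h1)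
  filter_upwards [eventually_eventually_nhds.2 hpb] with w hw
  refine lt_of_le_of_lt (hls_le hB ?_) h2
  exact eventually_prod_iff.2 ⟨pa, hpa, pb, hw, fun hx _ hy => (hp hx hy).le⟩

lemma hls_abs (hB : ∀ i z, |u i z| ≤ B) (z : Dom n) : |hls l u z| ≤ B := by
  rw [abs_le]
  constructor
  · by_contra h
    push Not at h
    obtain ⟨p, hp⟩ := (hls_ev hB h).exists
    linarith [(abs_le.1 (hB p.1 p.2)).1]
  · exact hls_le hB (.of_forall fun p => (abs_le.1 (hB _ _)).2)

lemma hls_shift (k : Dom n) (z : Dom n) :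
    hls l u (z + k) = hls l (fun i w => u i (w + k)) z := by
  unfold hls
  have h : l ×ˢ 𝓝 (z + k) = map (Prod.map id (fun w => w + k)) (l ×ˢ 𝓝 z) := by
    rw [← prod_map_map_eq']
    congr 1
    exact ((Homeomorph.addRight k).map_nhds_eq z).symm
  rw [h, limsup, limsup, map_map]
  rfl

/-- Stability of viscosity subsolutions under half-relaxed limits. -/
lemma hls_sub {G : Ham n} (hG : HCont G) {α lam : ℝ} (hα : 0 ≤ α)
    (hB : ∀ i z, |u i z| ≤ B)
    (hsub : ∀ ε > 0, ∀ᶠ i in l, ViscSub G α (lam + ε) (u i)) :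
    ViscSub G α lam (hls l u) := by
  refine ⟨hls_usc hB, ?_⟩
  intro φ hφ z hz
  by_contra hcon
  push Not at hcon
  set U := hls l u with hU
  -- perturbed test function
  set ψ : Dom n → ℝ := fun w => φ w + qf z w with hψ
  have hψC : ContDiff ℝ 1 ψ := hφ.add (qf_contDiff z)
  have hψz : ψ z = φ z := by simp [hψ, qf_self]
  have hop_eq' : hop G ψ z = hop G φ z := by
    apply hop_congr
    rw [hψ, fderiv_fun_add (hφ.differentiable (by norm_num) z)
      ((qf_contDiff z).differentiable (by norm_num) z), qf_fderiv, add_zero]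
  have hpos : lam < hop G ψ z + α * U z := by rw [hop_eq']; exact hcon
  obtain ⟨ε, hε, hε2⟩ : ∃ ε > 0, lam + ε < hop G ψ z + α * (U z - 2 * ε) := by
    have : Tendsto (fun ε : ℝ => hop G ψ z + α * (U z - 2 * ε) - (lam + ε)) (𝓝[>] 0)
        (𝓝 (hop G ψ z + α * (U z - 2 * 0) - (lam + 0))) := by
      apply Tendsto.mono_left _ nhdsWithin_le_nhds
      apply Continuous.tendsto
      fun_prop
    have h2 := this.eventually (lt_mem_nhds (a := 0) (by simp; linarith))
    obtain ⟨ε, h3, h4⟩ := (h2.and self_mem_nhdsWithin).exists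
    exact ⟨ε, h4, by linarith⟩
  -- good radius
  have hc1 : ∀ᶠ w in 𝓝 z, lam + ε < hop G ψ w + α * (U z - 2 * ε) :=
    ((hop_continuous hG hψC).add continuous_const).continuousAt.eventually (lt_mem_nhds hε2)
  have hc2 : ∀ᶠ w in 𝓝 z, ψ z - ε < ψ w :=
    hψC.continuous.continuousAt.eventually (lt_mem_nhds (by linarith))
  obtain ⟨r, hr, hball⟩ := Metric.nhds_basis_closedBall.eventually_iff.1 (hc1.and (hc2.and hz))
  have hr2 : 0 < r ^ 2 := by positivity
  -- sphere estimate
  have hcomp : IsCompact (Metric.sphere z r) := isCompact_sphere z r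
  have hsph : ∀ᶠ i in l, ∀ w ∈ Metric.sphere z r, u i w - ψ w < U z - ψ z - r ^ 2 / 2 := by
    have key : ∀ ζ ∈ Metric.sphere z r, ∀ᶠ p in l ×ˢ 𝓝 ζ,
        u p.1 p.2 - ψ p.2 < U z - ψ z - r ^ 2 / 2 := by
      intro ζ hζ
      have h1 : U ζ - φ ζ ≤ U z - φ z := (hball (Metric.sphere_subset_closedBall hζ)).2.2
      have h2 : r ^ 2 ≤ qf z ζ := by
        have := qf_dist z ζ; rw [Metric.mem_sphere.1 hζ] at this; exact this
      have h3 : U ζ < U z - ψ z + ψ ζ - r ^ 2 / 2 - r ^ 2 / 4 := by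
        simp only [hψ, qf_self]; linarith
      have h4 : ∀ᶠ p in l ×ˢ 𝓝 ζ, ψ ζ - r ^ 2 / 4 < ψ p.2 :=
        (hψC.continuous.continuousAt.eventually (lt_mem_nhds (by linarith))).prod_inr l
      filter_upwards [hls_ev hB h3, h4] with p hp1 hp2
      linarith
    have : ∀ᶠ p in l ×ˢ 𝓝ˢ (Metric.sphere z r),
        u p.1 p.2 - ψ p.2 < U z - ψ z - r ^ 2 / 2 := by
      rw [hcomp.prod_nhdsSet_eq_biSup]
      simpa [eventually_iSup] using key
    obtain ⟨pa, hpa, pb, hpb, hp⟩ := eventually_prod_iff.1 this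
    filter_upwards [hpa] with i hi w hw
    exact hp hi (hpb.self_of_nhdsSet w hw)
  -- approximating point
  set η := min (r ^ 2 / 2) ε with hη
  have hηpos : 0 < η := lt_min (by positivity) hε
  have hfr : ∃ᶠ p in l ×ˢ 𝓝 z, U z - η / 2 < u p.1 p.2 := hls_fr hB (by rw [← hU]; linarith)
  have hev : ∀ᶠ p in l ×ˢ 𝓝 z, (ψ p.2 < ψ z + η / 2 ∧ p.2 ∈ Metric.closedBall z r) :=
    ((hψC.continuous.continuousAt.eventually (gt_mem_nhds (by linarith))).and
      (Metric.closedBall_mem_nhds z hr)).prod_inr l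
  have hev2 : ∀ᶠ p in l ×ˢ 𝓝 z, ViscSub G α (lam + ε) (u p.1) ∧
      ∀ w ∈ Metric.sphere z r, u p.1 w - ψ w < U z - ψ z - r ^ 2 / 2 :=
    ((hsub ε hε).and hsph).prod_inl (𝓝 z)
  obtain ⟨⟨i, w₀⟩, h1, ⟨h2, h3⟩, h4, h5⟩ := (hfr.and_eventually (hev.and hev2)).exists
  simp only at h1 h2 h3 h4 h5
  obtain ⟨ζ, hζ, hmax⟩ := UpperSemicontinuousOn.exists_isMaxOn (s := Metric.closedBall z r)
    (f := fun w => u i w - ψ w) ⟨z, Metric.mem_closedBall_self hr.le⟩ (isCompact_closedBall z r) (by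
      have : UpperSemicontinuous (fun w => u i w + (- ψ w)) :=
        h4.1.add (hψC.continuous.neg.upperSemicontinuous)
      simpa [sub_eq_add_neg] using this.upperSemicontinuousOn _)
  have hge : U z - ψ z - η < u i ζ - ψ ζ := by
    have := hmax h3
    simp only [Set.mem_ofPred_eq] at this
    linarith
  have hzin : ζ ∈ Metric.ball z r := by
    rcases lt_or_eq_of_le (Metric.mem_closedBall.1 hζ) with h | h
    · exact h
    · have := h5 ζ h
      have := min_le_left (r ^ 2 / 2) ε
      linarith
  have hloc : IsLocalMax (fun w => u i w - ψ w) ζ := by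
    filter_upwards [Metric.isOpen_ball.mem_nhds hzin] with w hw
    exact hmax (Metric.ball_subset_closedBall hw)
  have hfin := h4.2 ψ hψC ζ hloc
  obtain ⟨hb1, hb2, -⟩ := hball hζ
  have hmin := min_le_right (r ^ 2 / 2) ε
  have : U z - 2 * ε ≤ u i ζ := by linarith
  have := mul_le_mul_of_nonneg_left this hα
  unfold hop at hb1
  linarith

end hls

/-! ## The Perron method -/

lemma hop_zero {n : ℕ} (G : Ham n) {φ : Dom n → ℝ} {z : Dom n} (hφ : DifferentiableAt ℝ φ z)
    (h : fderiv ℝ φ z = 0) : hop G φ z = G z.1 z.2.1 z.2.2 0 0 := by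
  rw [hop_eq G hφ.hasFDerivAt 0 (by simp [h])]
  simp [h]

lemma HShift.neg {n : ℕ} {G : Ham n} {k : Dom n} (h : HShift G k) : HShift G (-k) := by
  intro x y t p q
  have := h (x + (-k).1) (y + (-k).2.1) (t + (-k).2.2) p q
  simpa using this.symm

lemma perron {n : ℕ} {G : Ham n} (hG : HCont G) {α N : ℝ} (hα : 0 < α)
    (hN : ∀ x y t, |G x y t 0 0| ≤ α * N) :
    ∃ w v : Dom n → ℝ, ViscSub G α 0 w ∧ ViscSuper G α 0 v ∧ (∀ z, |w z| ≤ N) ∧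
      (∀ z, |v z| ≤ N) ∧ (∀ z, v z ≤ w z) ∧
      ∀ k, HShift G k → (∀ z, w (z + k) = w z) ∧ (∀ z, v (z + k) = v z) := by
  have hN0 : 0 ≤ N := by
    have h1 := (abs_nonneg _).trans (hN 0 0 0)
    exact nonneg_of_mul_nonneg_right h1 hα
  let S : Set (Dom n → ℝ) := {u | ViscSub G α 0 u ∧ ∀ z, |u z| ≤ N}
  have hconst : (fun _ : Dom n => -N) ∈ S := by
    refine ⟨⟨upperSemicontinuous_const, ?_⟩, fun z => by simp [abs_of_nonneg hN0]⟩
    intro φ hφ z hz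
    have hd := hφ.differentiable (by norm_num) z
    have h1 : fderiv ℝ φ z = 0 := by
      apply IsLocalMin.fderiv_eq_zero
      filter_upwards [hz] with w hw
      linarith
    have h2 := hop_zero G hd h1
    have h3 := (abs_le.1 (hN z.1 z.2.1 z.2.2)).2
    unfold hop at h2
    linarith
  have : Nonempty S := ⟨⟨_, hconst⟩⟩
  let fam : S → Dom n → ℝ := fun u => u.1
  have hfB : ∀ (u : S) z, |fam u z| ≤ N := fun u z => u.2.2 z
  set w : Dom n → ℝ := hls (⊤ : Filter S) fam with hw
  have hwB : ∀ z, |w z| ≤ N := fun z => hls_abs hfB z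
  have hwsub : ViscSub G α 0 w := by
    apply hls_sub hG hα.le hfB
    intro ε hε
    refine .of_forall fun u => ⟨u.2.1.1, fun φ hφ z hz => ?_⟩
    have := u.2.1.2 φ hφ z hz
    simp only [fam]
    linarith
  have hwS : w ∈ S := ⟨hwsub, hwB⟩
  have hwmax : ∀ u ∈ S, ∀ z, u z ≤ w z := by
    intro u hu z
    by_contra hlt
    push Not at hlt
    have h1 := hls_ev hfB hlt
    obtain ⟨pa, hpa, pb, hpb, hp⟩ := eventually_prod_iff.1 h1
    have h2 : pa ⟨u, hu⟩ := eventually_top.1 hpa _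
    have := hp h2 hpb.self_of_nhds
    simp only [fam] at this
    linarith
  have hwper : ∀ k, HShift G k → ∀ z, w (z + k) = w z := by
    have h0 : ∀ k, HShift G k → ∀ z, w (z + k) ≤ w z := fun k hk z =>
      hwmax (fun z => w (z + k)) ⟨hwsub.shift hk, fun z => hwB _⟩ z
    intro k hk z
    apply le_antisymm (h0 k hk z)
    have := h0 (-k) hk.neg (z + k)
    simpa using this
  -- lower envelope
  let nf : Unit → Dom n → ℝ := fun _ z => - w z
  have hnB : ∀ (i : Unit) z, |nf i z| ≤ N := fun i z => by simp only [nf, abs_neg]; exact hwB z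
  set v : Dom n → ℝ := fun z => - hls (⊤ : Filter Unit) nf z with hv
  have hvB : ∀ z, |v z| ≤ N := fun z => by
    simp only [hv, abs_neg]; exact hls_abs hnB z
  have hvlsc : LowerSemicontinuous v := by
    intro z c hc
    have := hls_usc (l := (⊤ : Filter Unit)) hnB z (-c) (by simp only [hv] at hc; linarith)
    filter_upwards [this] with z' hz'
    simp only [hv]; linarith
  have hvw : ∀ z, v z ≤ w z := by
    intro z
    by_contra hlt
    push Not at hlt
    have h1 : hls (⊤ : Filter Unit) nf z < - w z := by simp only [hv] at hlt; linarith
    have h2 := hls_ev hnB h1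
    obtain ⟨pa, hpa, pb, hpb, hp⟩ := eventually_prod_iff.1 h2
    obtain ⟨i, hi⟩ := hpa.exists
    have := hp hi hpb.self_of_nhds
    simp only [nf, lt_self_iff_false] at this
  have hvper : ∀ k, HShift G k → ∀ z, v (z + k) = v z := by
    intro k hk z
    simp only [hv, hls_shift]
    congr 2
    funext i w'
    simp only [nf, hwper k hk]
  have hvfr : ∀ z c, v z < c → ∃ᶠ z' in 𝓝 z, w z' < c := by
    intro z c hc
    have h1 := hls_fr (l := (⊤ : Filter Unit)) hnB (z := z) (c := -c)
      (by simp only [hv] at hc; linarith)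
    intro h2
    apply h1
    filter_upwards [Eventually.prod_inr h2 (⊤ : Filter Unit)] with p hp
    simp only [nf]
    intro h3
    apply hp
    linarith
  refine ⟨w, v, hwsub, ⟨hvlsc, ?_⟩, hwB, hvB, hvw, fun k hk => ⟨hwper k hk, hvper k hk⟩⟩
  intro φ hφ z hz
  by_contra hcon
  push Not at hcon
  have hcon' : hop G φ z + α * v z < 0 := hcon
  -- v z < N
  have hvN : v z < N := by
    by_contra hge
    push Not at hge
    have hvz : v z = N := le_antisymm (abs_le.1 (hvB z)).2 hge
    have h1 : fderiv ℝ φ z = 0 := by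
      apply IsLocalMax.fderiv_eq_zero
      filter_upwards [hz] with z' hz'
      have := (abs_le.1 (hvB z')).2
      linarith
    rw [hop_zero G (hφ.differentiable (by norm_num) z) h1, hvz] at hcon'
    have := (abs_le.1 (hN z.1 z.2.1 z.2.2)).1
    linarith
  set ψ₀ : Dom n → ℝ := fun z' => φ z' - φ z + v z - qf z z' with hψ₀
  have hψ₀C : ContDiff ℝ 1 ψ₀ :=
    ((hφ.sub contDiff_const).add contDiff_const).sub (qf_contDiff z)
  have hψ₀z : ψ₀ z = v z := by simp [hψ₀, qf_self]
  have hd : fderiv ℝ ψ₀ z = fderiv ℝ φ z := by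
    have h1 : HasFDerivAt φ (fderiv ℝ φ z) z := (hφ.differentiable (by norm_num) z).hasFDerivAt
    have h2 : HasFDerivAt (qf z) (0 : Dom n →L[ℝ] ℝ) z := by
      rw [← qf_fderiv z]
      exact ((qf_contDiff z).differentiable (by norm_num) z).hasFDerivAt
    have h3 := ((h1.sub_const (φ z)).add_const (v z)).sub h2
    rw [sub_zero] at h3
    exact h3.fderiv
  have hop0 : hop G ψ₀ z + α * ψ₀ z < 0 := by rw [hop_congr G hd, hψ₀z]; exact hcon'
  obtain ⟨κ₀, hκ₀, hκ₁, hκ₂⟩ : ∃ κ₀ > 0, hop G ψ₀ z + α * (ψ₀ z + κ₀) < 0 ∧ ψ₀ z + κ₀ < N := by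
    have h1 : Tendsto (fun ε : ℝ => hop G ψ₀ z + α * (ψ₀ z + ε)) (𝓝[>] 0)
        (𝓝 (hop G ψ₀ z + α * (ψ₀ z + 0))) :=
      (Continuous.tendsto (by fun_prop) 0).mono_left nhdsWithin_le_nhds
    have h2 : Tendsto (fun ε : ℝ => ψ₀ z + ε) (𝓝[>] 0) (𝓝 (ψ₀ z + 0)) :=
      (Continuous.tendsto (by fun_prop) 0).mono_left nhdsWithin_le_nhds
    have h3 := h1.eventually_lt_const (u := 0) (by simpa using hop0)
    have h4 := h2.eventually_lt_const (u := N) (by rw [hψ₀z]; simpa using hvN)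
    obtain ⟨ε, h5, h6, h7⟩ := (h3.and (h4.and self_mem_nhdsWithin)).exists
    exact ⟨ε, h7, h5, h6⟩
  have hc1 : ∀ᶠ z' in 𝓝 z, hop G ψ₀ z' + α * (ψ₀ z' + κ₀) < 0 :=
    ((hop_continuous hG hψ₀C).add (continuous_const.mul
      (hψ₀C.continuous.add continuous_const))).continuousAt.eventually (gt_mem_nhds hκ₁)
  have hc2 : ∀ᶠ z' in 𝓝 z, ψ₀ z' + κ₀ < N :=
    (hψ₀C.continuous.add continuous_const).continuousAt.eventually (gt_mem_nhds hκ₂)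
  obtain ⟨r, hr, hball⟩ := Metric.nhds_basis_ball.eventually_iff.1 (hc1.and (hc2.and hz))
  set κ := min κ₀ (r ^ 2 / 8) with hκdef
  have hκ : 0 < κ := lt_min hκ₀ (by positivity)
  have hκle : κ ≤ κ₀ := min_le_left _ _
  have hκr : κ ≤ r ^ 2 / 8 := min_le_right _ _
  set ψ : Dom n → ℝ := fun z' => ψ₀ z' + κ with hψ
  have hψC : ContDiff ℝ 1 ψ := hψ₀C.add contDiff_const
  have hψop : ∀ z', hop G ψ z' = hop G ψ₀ z' := fun z' => hop_congr G (by
    simp only [hψ]; exact fderiv_add_const κ)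
  -- outside the half ball, ψ < w
  have hout : ∀ z', dist z' z < r → r / 2 < dist z' z → ψ z' < w z' := by
    intro z' h1 h2
    have h3 := (hball h1).2.2
    have h4 := qf_dist z z'
    have h5 : (r / 2) ^ 2 ≤ dist z' z ^ 2 := by gcongr
    have h6 := hvw z'
    have : 0 < r ^ 2 := by positivity
    simp only [hψ, hψ₀]
    nlinarith
  classical
  set W : Dom n → ℝ := fun z' => if dist z' z < r then max (w z') (ψ z') else w z' with hW
  have hwW : ∀ z', w z' ≤ W z' := by
    intro z'
    simp only [hW]
    split_ifs
    · exact le_max_left _ _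
    · exact le_rfl
  have hWin : ∀ z', dist z' z < r → W z' = max (w z') (ψ z') := fun z' h => by
    simp only [hW, if_pos h]
  have hWS : W ∈ S := by
    refine ⟨⟨?_, ?_⟩, ?_⟩
    · intro ζ c hc
      by_cases hζ : dist ζ z < r
      · rw [hWin ζ hζ] at hc
        have ho : ∀ᶠ z' in 𝓝 ζ, dist z' z < r := Metric.isOpen_ball.mem_nhds hζ
        filter_upwards [ho, hwsub.1 ζ c (lt_of_le_of_lt (le_max_left _ _) hc),
          hψC.continuous.continuousAt.eventually
            (gt_mem_nhds (lt_of_le_of_lt (le_max_right _ _) hc))] with z' h1 h2 h3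
        rw [hWin z' h1]
        exact max_lt h2 h3
      · have h0 : W ζ = w ζ := by simp only [hW, if_neg hζ]
        rw [h0] at hc
        have ho : ∀ᶠ z' in 𝓝 ζ, r / 2 < dist z' z :=
          (continuous_id.dist continuous_const).continuousAt.eventually
            (lt_mem_nhds (by push Not at hζ; simp only [id]; linarith))
        filter_upwards [ho, hwsub.1 ζ c hc] with z' h1 h2
        by_cases hz' : dist z' z < r
        · rw [hWin z' hz', max_eq_left (hout z' hz' h1).le]; exact h2
        · simp only [hW, if_neg hz']; exact h2
    · intro χ hχ ζ hζ
      by_cases heq : W ζ = w ζ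
      · have := hwsub.2 χ hχ ζ (by
          filter_upwards [hζ] with z' hz'
          have := hwW z'
          linarith)
        rw [heq]; exact this
      · have hin : dist ζ z < r := by
          by_contra hcon2
          exact heq (by simp only [hW, if_neg hcon2])
        have hWψ : W ζ = ψ ζ := by
          rw [hWin ζ hin] at heq ⊢
          rcases max_choice (w ζ) (ψ ζ) with h | h
          · exact absurd h heq
          · exact h
        have hlm : IsLocalMax (fun z' => ψ z' - χ z') ζ := by
          have ho : ∀ᶠ z' in 𝓝 ζ, dist z' z < r := Metric.isOpen_ball.mem_nhds hin
          filter_upwards [hζ, ho] with z' h1 h2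
          rw [hWin z' h2, hWψ] at h1
          have := le_max_right (w z') (ψ z')
          linarith
        have hder : fderiv ℝ ψ ζ = fderiv ℝ χ ζ := by
          have h1 := hlm.fderiv_eq_zero
          rw [fderiv_fun_sub (hψC.differentiable (by norm_num) ζ)
            (hχ.differentiable (by norm_num) ζ)] at h1
          exact sub_eq_zero.1 h1
        have h1 := (hball hin).1
        have h2 : hop G χ ζ = hop G ψ₀ ζ := by rw [← hψop, hop_congr G hder]
        have h3 : α * ψ ζ ≤ α * (ψ₀ ζ + κ₀) :=
          mul_le_mul_of_nonneg_left (by simp only [hψ]; linarith) hα.le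
        rw [hWψ]
        unfold hop at h2 h1
        linarith
    · intro z'
      rw [abs_le]
      refine ⟨(abs_le.1 (hwB z')).1.trans (hwW z'), ?_⟩
      by_cases hz' : dist z' z < r
      · rw [hWin z' hz']
        refine max_le (abs_le.1 (hwB z')).2 ?_
        have := (hball hz').2.1
        simp only [hψ]; linarith
      · simp only [hW, if_neg hz']; exact (abs_le.1 (hwB z')).2
  have hWw := hwmax W hWS
  have h1 := hvfr z (v z + κ / 2) (by linarith)
  have h2 : ∀ᶠ z' in 𝓝 z, v z + κ / 2 < ψ z' :=
    hψC.continuous.continuousAt.eventually (lt_mem_nhds (by simp only [hψ, hψ₀z]; linarith))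
  have h3 : ∀ᶠ z' in 𝓝 z, dist z' z < r := Metric.ball_mem_nhds z hr
  obtain ⟨z', h4, h5, h6⟩ := (h1.and_eventually (h2.and h3)).exists
  have h7 := hWw z'
  rw [hWin z' h6] at h7
  have := le_max_right (w z') (ψ z')
  linarith

/-! ## Consequences of (H3) -/

lemma lip_of_ae_deriv {f : ℝ → ℝ} (hf : LocallyLipschitz f) {a b K : ℝ}
    (h : ∀ᵐ s : ℝ, s ∈ Set.uIcc a b → |deriv f s| ≤ K) : |f b - f a| ≤ K * |b - a| := by
  obtain ⟨C, hC⟩ := LocallyLipschitzOn.exists_lipschitzOnWith_of_compact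
    (isCompact_uIcc (a := a) (b := b)) (hf.locallyLipschitzOn)
  have h1 := hC.absolutelyContinuousOnInterval.integral_deriv_eq_sub
  rw [← h1, ← Real.norm_eq_abs]
  apply intervalIntegral.norm_integral_le_of_norm_le_const_ae
  filter_upwards [h] with s hs hs2
  exact hs (Set.uIoc_subset_uIcc hs2)

instance vol_haar (n : ℕ) : (volume : Measure (Xi n)).IsAddHaarMeasure := by
  have : (volume : Measure (Euc n × ℝ)).IsAddHaarMeasure :=
    Measure.prod.instIsAddHaarMeasure _ _
  have : (volume : Measure (ℝ × Euc n × ℝ)).IsAddHaarMeasure :=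
    Measure.prod.instIsAddHaarMeasure _ _
  have : (volume : Measure (ℝ × ℝ × Euc n × ℝ)).IsAddHaarMeasure :=
    Measure.prod.instIsAddHaarMeasure _ _
  exact Measure.prod.instIsAddHaarMeasure _ _

lemma ae_line {n : ℕ} {P : Xi n → Prop} (h : ∀ᵐ ξ ∂(volume : Measure (Xi n)), P ξ) (e : Xi n) :
    ∀ᵐ ξ ∂(volume : Measure (Xi n)), ∀ᵐ s : ℝ, P (ξ + s • e) := by
  set T := toMeasurable (volume : Measure (Xi n)) {ξ | ¬ P ξ} with hT
  have hT0 : (volume : Measure (Xi n)) T = 0 := by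
    rw [hT, measure_toMeasurable]; exact h
  have hTm : MeasurableSet Tᶜ := (measurableSet_toMeasurable _ _).compl
  have h2 : ∀ᵐ ξ ∂(volume : Measure (Xi n)), ξ ∈ Tᶜ := by
    rw [ae_iff]; simpa using hT0
  have h3 := (ae_ae_add_linearMap_mem_iff (LinearMap.toSpanSingleton ℝ (Xi n) e)
    (volume : Measure ℝ) (volume : Measure (Xi n)) hTm).2 h2
  filter_upwards [h3] with ξ hξ
  filter_upwards [hξ] with s hs
  by_contra hc
  exact hs (subset_toMeasurable _ _ hc)

lemma all_of_ae {n : ℕ} {f g : Xi n → ℝ} (hf : Continuous f) (hg : Continuous g)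
    (h : ∀ᵐ ξ ∂(volume : Measure (Xi n)), f ξ ≤ g ξ) (ξ : Xi n) : f ξ ≤ g ξ := by
  have h1 : Dense {ξ | f ξ ≤ g ξ} := Measure.dense_of_ae h
  have h2 : IsClosed {ξ | f ξ ≤ g ξ} := isClosed_le hf hg
  have h3 : {ξ | f ξ ≤ g ξ} = Set.univ := by rw [← h2.closure_eq]; exact h1.closure_eq
  have : ξ ∈ {ξ | f ξ ≤ g ξ} := by rw [h3]; trivial
  exact this

lemma locLip_comp {f : ℝ × ℝ × ℝ → ℝ} (hf : LocallyLipschitz f) {g : ℝ → ℝ × ℝ × ℝ}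
    (hg : LipschitzWith 1 g) : LocallyLipschitz (fun s => f (g s)) :=
  hf.comp hg.locallyLipschitz

lemma F1 {n : ℕ} {F : Ham n} {C₃ C₄ C₅ : ℝ} (h1 : HypH1 F) (h3 : HypH3 F 0 C₃ C₄ C₅)
    (x : Euc n) (y y' t : ℝ) (p : Euc n) (q : ℝ) :
    |F x y' t p q - F x y t p q| ≤ C₃ * |q| * |y' - y| := by
  obtain ⟨hC3, hC4, hC5, hL, hae⟩ := h3
  have hF := h1.1
  set h := y' - y with hh
  have key := all_of_ae (n := n)
    (f := fun ξ => |F ξ.1 (ξ.2.1 + h) ξ.2.2.1 ξ.2.2.2.1 ξ.2.2.2.2 -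
      F ξ.1 ξ.2.1 ξ.2.2.1 ξ.2.2.2.1 ξ.2.2.2.2|)
    (g := fun ξ => C₃ * |ξ.2.2.2.2| * |h|)
    (((hF.comp (f := fun ξ : Xi n => ((ξ.1, ξ.2.1 + h, ξ.2.2) : Xi n)) (by fun_prop)).sub
      hF).abs) (by fun_prop) (by
      filter_upwards [ae_line hae ((0, 1, 0, 0, 0) : Xi n)] with ξ hξ
      have hl : LocallyLipschitz (fun s => F ξ.1 (ξ.2.1 + s) ξ.2.2.1 ξ.2.2.2.1 ξ.2.2.2.2) :=
        locLip_comp (hL ξ.1 ξ.2.2.2.1) (g := fun s => (ξ.2.1 + s, ξ.2.2.1, ξ.2.2.2.2)) (by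
          refine LipschitzWith.of_dist_le_mul fun a b => ?_
          simp [Prod.dist_eq])
      have := lip_of_ae_deriv hl (a := 0) (b := h) (K := C₃ * |ξ.2.2.2.2|) (by
        filter_upwards [hξ] with s hs _
        have h5 := hs.1
        simp only [Prod.fst_add, Prod.snd_add, Prod.smul_fst, Prod.smul_snd, smul_zero, add_zero,
          smul_eq_mul, mul_one, mul_zero] at h5
        rw [deriv_comp_const_add (f := fun y => F ξ.1 y ξ.2.2.1 ξ.2.2.2.1 ξ.2.2.2.2)]
        exact h5)
      simpa using this)
    ((x, y, t, p, q) : Xi n)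
  simpa [hh] using key

lemma F3 {n : ℕ} {F : Ham n} {C₃ C₄ C₅ : ℝ} (h1 : HypH1 F) (h3 : HypH3 F 0 C₃ C₄ C₅)
    (x : Euc n) (y t : ℝ) (p : Euc n) (q q' : ℝ) :
    |F x y t p q' - F x y t p q| ≤ C₅ * |q' - q| := by
  obtain ⟨hC3, hC4, hC5, hL, hae⟩ := h3
  have hF := h1.1
  set h := q' - q with hh
  have key := all_of_ae (n := n)
    (f := fun ξ => |F ξ.1 ξ.2.1 ξ.2.2.1 ξ.2.2.2.1 (ξ.2.2.2.2 + h) -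
      F ξ.1 ξ.2.1 ξ.2.2.1 ξ.2.2.2.1 ξ.2.2.2.2|)
    (g := fun ξ => C₅ * |h|)
    (((hF.comp (f := fun ξ : Xi n =>
      ((ξ.1, ξ.2.1, ξ.2.2.1, ξ.2.2.2.1, ξ.2.2.2.2 + h) : Xi n)) (by fun_prop)).sub
      hF).abs) (by fun_prop) (by
      filter_upwards [ae_line hae ((0, 0, 0, 0, 1) : Xi n)] with ξ hξ
      have hl : LocallyLipschitz (fun s => F ξ.1 ξ.2.1 ξ.2.2.1 ξ.2.2.2.1 (ξ.2.2.2.2 + s)) :=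
        locLip_comp (hL ξ.1 ξ.2.2.2.1) (g := fun s => (ξ.2.1, ξ.2.2.1, ξ.2.2.2.2 + s)) (by
          refine LipschitzWith.of_dist_le_mul fun a b => ?_
          simp [Prod.dist_eq])
      have := lip_of_ae_deriv hl (a := 0) (b := h) (K := C₅) (by
        filter_upwards [hξ] with s hs _
        have h5 := hs.2.2
        simp only [Prod.fst_add, Prod.snd_add, Prod.smul_fst, Prod.smul_snd, smul_zero, add_zero,
          smul_eq_mul, mul_one, mul_zero] at h5
        rw [deriv_comp_const_add (f := fun q => F ξ.1 ξ.2.1 ξ.2.2.1 ξ.2.2.2.1 q)]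
        exact h5)
      simpa using this)
    ((x, y, t, p, q) : Xi n)
  simpa [hh] using key

lemma gron {g : ℝ → ℝ} (hg : LocallyLipschitz g) {C A h : ℝ} (hC : 0 ≤ C) (hA : 0 ≤ A)
    (hh : C * |h| ≤ 1 / 2)
    (hd : ∀ᵐ s : ℝ, |deriv g s| ≤ C * (A + |g s|)) :
    |g h - g 0| ≤ 2 * C * |h| * (A + |g 0|) := by
  have hc : Continuous g := hg.continuous
  obtain ⟨m, hm, hmax⟩ := (isCompact_uIcc (a := 0) (b := h)).exists_isMaxOn
    Set.nonempty_uIcc (f := fun s => |g s - g 0|) (by fun_prop)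
  set S := |g m - g 0| with hS
  have hle : ∀ s ∈ Set.uIcc 0 h, |g s - g 0| ≤ S := fun s hs => hmax hs
  have hS0 : 0 ≤ S := abs_nonneg _
  have hmh : |m - 0| ≤ |h| := by
    have := Set.abs_sub_left_of_mem_uIcc hm
    simpa using this
  have h1 := lip_of_ae_deriv hg (a := 0) (b := m) (K := C * (A + (|g 0| + S))) (by
    filter_upwards [hd] with s hs hs2
    have hs3 : s ∈ Set.uIcc 0 h := Set.uIcc_subset_uIcc_left hm hs2
    have h2 : |g s| ≤ |g 0| + S := by
      have := abs_add_le (g 0) (g s - g 0)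
      have h4 := hle s hs3
      simp only [add_sub_cancel] at this
      linarith
    refine hs.trans ?_
    gcongr)
  have h0 : |g h - g 0| ≤ S := hle h Set.right_mem_uIcc
  have hA1 : 0 ≤ C * (A + (|g 0| + S)) := by positivity
  have h7 : S ≤ C * (A + (|g 0| + S)) * |h| :=
    h1.trans (mul_le_mul_of_nonneg_left hmh hA1)
  nlinarith

lemma F2 {n : ℕ} {F : Ham n} {C₃ C₄ C₅ : ℝ} (h1 : HypH1 F) (h3 : HypH3 F 0 C₃ C₄ C₅)
    (x : Euc n) (y t t' : ℝ) (p : Euc n) (q : ℝ) (ht : C₄ * |t' - t| ≤ 1 / 2) :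
    |F x y t' p q - F x y t p q| ≤ 2 * C₄ * |t' - t| * (1 + |q| + |F x y t p q|) := by
  obtain ⟨hC3, hC4, hC5, hL, hae⟩ := h3
  have hF := h1.1
  set h := t' - t with hh
  have key := all_of_ae (n := n)
    (f := fun ξ => |F ξ.1 ξ.2.1 (ξ.2.2.1 + h) ξ.2.2.2.1 ξ.2.2.2.2 -
      F ξ.1 ξ.2.1 ξ.2.2.1 ξ.2.2.2.1 ξ.2.2.2.2|)
    (g := fun ξ => 2 * C₄ * |h| * (1 + |ξ.2.2.2.2| + |F ξ.1 ξ.2.1 ξ.2.2.1 ξ.2.2.2.1 ξ.2.2.2.2|))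
    (((hF.comp (f := fun ξ : Xi n => ((ξ.1, ξ.2.1, ξ.2.2.1 + h, ξ.2.2.2) : Xi n))
      (by fun_prop)).sub hF).abs) (continuous_const.mul
        (Continuous.add (by fun_prop) hF.abs)) (by
      filter_upwards [ae_line hae ((0, 0, 1, 0, 0) : Xi n)] with ξ hξ
      have hl : LocallyLipschitz (fun s => F ξ.1 ξ.2.1 (ξ.2.2.1 + s) ξ.2.2.2.1 ξ.2.2.2.2) :=
        locLip_comp (hL ξ.1 ξ.2.2.2.1) (g := fun s => (ξ.2.1, ξ.2.2.1 + s, ξ.2.2.2.2)) (by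
          refine LipschitzWith.of_dist_le_mul fun a b => ?_
          simp [Prod.dist_eq])
      have := gron hl (C := C₄) (A := 1 + |ξ.2.2.2.2|) (h := h) hC4 (by positivity) ht (by
        filter_upwards [hξ] with s hs
        have h5 := hs.2.1
        simp only [Prod.fst_add, Prod.snd_add, Prod.smul_fst, Prod.smul_snd, smul_zero, add_zero,
          smul_eq_mul, mul_one, mul_zero] at h5
        rw [deriv_comp_const_add (f := fun t => F ξ.1 ξ.2.1 t ξ.2.2.2.1 ξ.2.2.2.2)]
        exact h5)
      simpa using this)
    ((x, y, t, p, q) : Xi n)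
  simpa [hh] using key

lemma F4 {n : ℕ} {F : Ham n} {C₃ C₄ C₅ : ℝ} (h1 : HypH1 F) (h2 : HypH2' F)
    (h3 : HypH3 F 0 C₃ C₄ C₅) : ∃ C₁ C₂ : ℝ, 0 < C₁ ∧ 0 < C₂ ∧
      ∀ x y t p q, C₁ * ‖p‖ - C₂ - C₅ * |q| ≤ F x y t p q := by
  obtain ⟨C₁, C₂, hC1, hC2, h⟩ := h2 1 one_pos
  refine ⟨C₁, C₂, hC1, hC2, fun x y t p q => ?_⟩
  have h4 := h x y t p 0 (by simp)
  have h5 := (abs_le.1 (F3 h1 h3 x y t p 0 q)).1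
  rw [sub_zero] at h5
  linarith

/-! ## Preparations for the doubling of variables -/

/-- The squared positive part. -/
def pp (s : ℝ) : ℝ := max s 0 ^ 2

lemma pp_hasDerivAt (s : ℝ) : HasDerivAt pp (2 * max s 0) s := by
  have hne : ∀ y ≠ (0 : ℝ), HasDerivAt pp (2 * max y 0) y := by
    intro y hy
    rcases lt_or_gt_of_ne hy with h | h
    · rw [max_eq_right h.le, mul_zero]
      refine (hasDerivAt_const y (0 : ℝ)).congr_of_eventuallyEq ?_
      filter_upwards [gt_mem_nhds h] with z hz
      simp [pp, max_eq_right hz.le]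
    · rw [max_eq_left h.le]
      have h1 : HasDerivAt (fun z : ℝ => z ^ 2) (2 * y) y := by simpa using hasDerivAt_pow 2 y
      refine h1.congr_of_eventuallyEq ?_
      filter_upwards [lt_mem_nhds h] with z hz
      simp [pp, max_eq_left hz.le]
  by_cases hs : s = 0
  · subst hs
    refine hasDerivAt_of_hasDerivAt_of_ne (g := fun y => 2 * max y 0) hne ?_ ?_
    · unfold pp; fun_prop
    · fun_prop
  · exact hne s hs

lemma pp_contDiff : ContDiff ℝ 1 pp := by
  rw [contDiff_one_iff_deriv]
  refine ⟨fun s => (pp_hasDerivAt s).differentiableAt, ?_⟩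
  have : deriv pp = fun s => 2 * max s 0 := funext fun s => (pp_hasDerivAt s).deriv
  rw [this]; fun_prop

lemma sep_hop {n : ℕ} (G : Ham n) {f : Euc n → ℝ} {g h : ℝ → ℝ} {z : Dom n} {a : Euc n} {b c : ℝ}
    (hf : HasFDerivAt f (innerSL ℝ a) z.1) (hg : HasDerivAt g b z.2.1) (hh : HasDerivAt h c z.2.2) :
    hop G (fun w => f w.1 + g w.2.1 + h w.2.2) z = c + G z.1 z.2.1 z.2.2 a b := by
  have h1 : HasFDerivAt (fun w : Dom n => f w.1) _ z := hf.comp z hasFDerivAt_fst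
  have h2 : HasFDerivAt (fun w : Dom n => g w.2.1) _ z :=
    hg.hasFDerivAt.comp z (hasFDerivAt_fst.comp z hasFDerivAt_snd)
  have h3 : HasFDerivAt (fun w : Dom n => h w.2.2) _ z :=
    hh.hasFDerivAt.comp z (hasFDerivAt_snd.comp z hasFDerivAt_snd)
  have h4 : HasFDerivAt (fun w : Dom n => f w.1 + g w.2.1 + h w.2.2) _ z := (h1.add h2).add h3
  rw [hop_eq G h4 a (by intro v; simp)]
  simp

lemma STPeriodic.int {n : ℕ} {u : Dom n → ℝ} (h : STPeriodic u) (k : Fin n → ℤ) (m l : ℤ)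
    (x : Euc n) (y t : ℝ) : u (x + intVec k, y + m, t + l) = u (x, y, t) := by
  rw [h.1]
  have h1 : Function.Periodic (fun y => u (x, y, t + l)) 1 := fun y => h.2.1 _ _ _
  have h2 : Function.Periodic (fun t => u (x, y, t)) 1 := fun t => h.2.2 _ _ _
  have h3 := h1.int_mul m y
  have h4 := h2.int_mul l t
  simp only [mul_one] at h3 h4
  rw [h3, h4]

lemma exists_intVec {n : ℕ} (x : Euc n) : ∃ k : Fin n → ℤ, ‖x + intVec k‖ ≤ √n := by
  refine ⟨fun i => -⌊x i⌋, ?_⟩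
  rw [EuclideanSpace.norm_eq]
  apply Real.sqrt_le_sqrt
  calc _ ≤ ∑ _i : Fin n, (1 : ℝ) := by
        apply Finset.sum_le_sum
        intro i _
        have h1 := Int.fract_nonneg (x i)
        have h2 := (Int.fract_lt_one (x i)).le
        have h3 : (x + intVec fun i => -⌊x i⌋) i = Int.fract (x i) := by
          simp [intVec, Int.fract, sub_eq_add_neg]
        rw [h3, Real.norm_eq_abs, sq_abs]
        nlinarith
    _ = n := by simp

lemma intVec_neg {n : ℕ} (k : Fin n → ℤ) : intVec (-k) = - intVec k := by
  ext i; simp [intVec]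

/-- The doubled functional. -/
def Phi {n : ℕ} (u v : Dom n → ℝ) (P σ a b : ℝ) (Z : Dom n × Dom n) : ℝ :=
  u Z.1 - v Z.2 - P * (σ * (Z.2.2.1 - Z.1.2.1))
    - b * (pp (-(σ * (Z.2.2.1 - Z.1.2.1))) + (Z.1.2.2 - Z.2.2.2) ^ 2)
    - a * ‖Z.1.1 - Z.2.1‖ ^ 2

lemma phi_bound {S X T P B a b : ℝ} (hP : 0 ≤ P) (hB : 0 ≤ B)
    (ha : 1 ≤ a) (hb : 1 ≤ b)
    (h : -(2 * B) ≤ 2 * B - P * S - b * (pp (-S) + T ^ 2) - a * X ^ 2) :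
    max (-S) 0 ≤ P + 4 * B + 1 ∧
    b * T ^ 2 + a * X ^ 2 ≤ 4 * B + P * (P + 4 * B + 1) := by
  have h1 : - P * S ≤ P * max (-S) 0 := by
    have := mul_le_mul_of_nonneg_left (le_max_left (-S) 0) hP
    linarith
  have hm : 0 ≤ max (-S) 0 := le_max_right _ _
  unfold pp at h
  set m := max (-S) 0
  have hT : 0 ≤ b * T ^ 2 := by positivity
  have hX : 0 ≤ a * X ^ 2 := by positivity
  have hbm : m ^ 2 ≤ b * m ^ 2 := by nlinarith [sq_nonneg m]
  have h2 : m ≤ P + 4 * B + 1 := by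
    by_contra hc
    push Not at hc
    nlinarith
  refine ⟨h2, ?_⟩
  have := mul_le_mul_of_nonneg_left h2 hP
  nlinarith

lemma phi_max {n : ℕ} {u v : Dom n → ℝ} {B P σ : ℝ} (hu : UpperSemicontinuous u)
    (hv : LowerSemicontinuous v) (huB : ∀ z, |u z| ≤ B) (hvB : ∀ z, |v z| ≤ B)
    (hup : STPeriodic u) (hvp : STPeriodic v) (hσ : σ = 1 ∨ σ = -1) (hP : 0 ≤ P) :
    ∃ R : ℝ, 0 ≤ R ∧ ∀ a b : ℝ, 1 ≤ a → 1 ≤ b → ∃ Z : Dom n × Dom n,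
      ‖Z‖ ≤ R ∧ ∀ Z', Phi u v P σ a b Z' ≤ Phi u v P σ a b Z := by
  have hB : 0 ≤ B := (abs_nonneg _).trans (huB 0)
  set D := 4 * B + P * (P + 4 * B + 1) with hD
  have hD0 : 0 ≤ D := by positivity
  have hσσ : σ * σ = 1 := by rcases hσ with h | h <;> rw [h] <;> norm_num
  have hσa : |σ| = 1 := by rcases hσ with h | h <;> rw [h] <;> norm_num
  set R := √n + 1 + (D + 1) + (P + 4 * B + 1) with hR
  have hR0 : 0 ≤ R := by positivity
  refine ⟨R, hR0, fun a b ha hb => ?_⟩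
  have husc : UpperSemicontinuous (Phi u v P σ a b) := by
    have h1 : UpperSemicontinuous (fun Z : Dom n × Dom n => u Z.1) :=
      hu.comp continuous_fst
    have h2 : UpperSemicontinuous (fun Z : Dom n × Dom n => - v Z.2) := by
      intro Z c hc
      have := hv Z.2 (-c) (by linarith)
      filter_upwards [(continuous_snd.tendsto Z).eventually this] with w hw using by linarith
    have h3 : Continuous (fun Z : Dom n × Dom n => - P * (σ * (Z.2.2.1 - Z.1.2.1))
      - b * (pp (-(σ * (Z.2.2.1 - Z.1.2.1))) + (Z.1.2.2 - Z.2.2.2) ^ 2)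
      - a * ‖Z.1.1 - Z.2.1‖ ^ 2) := by
      have := pp_contDiff.continuous
      fun_prop
    have h4 := (h1.add h2).add h3.upperSemicontinuous
    have h5 : Phi u v P σ a b = fun Z : Dom n × Dom n => (u Z.1 + - v Z.2) +
      (- P * (σ * (Z.2.2.1 - Z.1.2.1))
      - b * (pp (-(σ * (Z.2.2.1 - Z.1.2.1))) + (Z.1.2.2 - Z.2.2.2) ^ 2)
      - a * ‖Z.1.1 - Z.2.1‖ ^ 2) := by
      funext Z; simp only [Phi]; ring
    rw [h5]; exact h4
  obtain ⟨Z, hZ, hmax⟩ := UpperSemicontinuousOn.exists_isMaxOn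
    (s := Metric.closedBall (0 : Dom n × Dom n) R)
    ⟨0, Metric.mem_closedBall_self hR0⟩ (isCompact_closedBall _ _) (husc.upperSemicontinuousOn _)
  refine ⟨Z, by simpa using hZ, ?_⟩
  suffices hred : ∀ Z', Phi u v P σ a b 0 ≤ Phi u v P σ a b Z' →
      ∃ Z'' ∈ Metric.closedBall (0 : Dom n × Dom n) R, Phi u v P σ a b Z' ≤ Phi u v P σ a b Z'' by
    intro Z'
    rcases le_total (Phi u v P σ a b 0) (Phi u v P σ a b Z') with h | h
    · obtain ⟨Z'', h1, h2⟩ := hred Z' h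
      exact h2.trans (hmax h1)
    · exact h.trans (hmax (Metric.mem_closedBall_self hR0))
  rintro ⟨⟨x, y, t⟩, ⟨x', y', t'⟩⟩ hge
  have hb0 : -(2 * B) ≤ 2 * B - P * (σ * (y' - y)) - b * (pp (-(σ * (y' - y))) + (t - t') ^ 2)
      - a * ‖x - x'‖ ^ 2 := by
    have h0 : Phi u v P σ a b 0 = u 0 - v 0 := by simp [Phi, pp]
    rw [h0] at hge
    simp only [Phi] at hge
    have := abs_le.1 (huB 0)
    have := abs_le.1 (hvB 0)
    have := abs_le.1 (huB (x, y, t))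
    have := abs_le.1 (hvB (x', y', t'))
    linarith
  obtain ⟨hS, hTX⟩ := phi_bound hP hB ha hb hb0
  have hT : |t - t'| ≤ D + 1 := by
    have h1 : 0 ≤ a * ‖x - x'‖ ^ 2 := by positivity
    have h2 : (t - t') ^ 2 ≤ b * (t - t') ^ 2 := by nlinarith [sq_nonneg (t - t')]
    have h3 := sq_abs (t - t')
    by_contra hc
    push Not at hc
    nlinarith
  have hX : ‖x - x'‖ ≤ D + 1 := by
    have h1 : 0 ≤ b * (t - t') ^ 2 := by positivity
    have h2 : ‖x - x'‖ ^ 2 ≤ a * ‖x - x'‖ ^ 2 := by nlinarith [sq_nonneg ‖x - x'‖]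
    by_contra hc
    push Not at hc
    nlinarith
  obtain ⟨k, hk⟩ := exists_intVec x
  set s := σ * (y' - y) with hs
  -- shift in the second variable
  obtain ⟨j, hj0, hj1, hj2⟩ : ∃ j : ℤ, P * (s - j) ≤ P * s ∧ pp (-(s - j)) = pp (-s) ∧
      |s - j| ≤ P + 4 * B + 1 := by
    rcases le_total 0 s with h | h
    · have hj : (0 : ℝ) ≤ ⌊s⌋ := by exact_mod_cast Int.floor_nonneg.2 h
      refine ⟨⌊s⌋, ?_, ?_, ?_⟩
      · nlinarith
      · have h1 : 0 ≤ s - ⌊s⌋ := Int.fract_nonneg s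
        unfold pp
        rw [max_eq_right (by linarith), max_eq_right (by linarith)]
      · have h1 : 0 ≤ s - ⌊s⌋ := Int.fract_nonneg s
        have h2 : s - ⌊s⌋ < 1 := Int.fract_lt_one s
        rw [abs_of_nonneg h1]; linarith
    · refine ⟨0, by simp, by simp, ?_⟩
      rw [max_eq_left (by linarith)] at hS
      simp only [Int.cast_zero, sub_zero]
      rw [abs_of_nonpos h]; exact hS
  obtain ⟨σi, hσi⟩ : ∃ σi : ℤ, (σi : ℝ) = σ := by
    rcases hσ with h | h
    · exact ⟨1, by rw [h]; simp⟩
    · exact ⟨-1, by rw [h]; simp⟩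
  have hcast : ((-⌊y⌋ - σi * j : ℤ) : ℝ) = -⌊y⌋ - σ * j := by push_cast; rw [hσi]
  refine ⟨((x + intVec k, y + (-⌊y⌋ : ℤ), t + (-⌊t⌋ : ℤ)),
    (x' + intVec k, y' + (-⌊y⌋ - σi * j : ℤ), t' + (-⌊t⌋ : ℤ))), ?_, ?_⟩
  · have e1 : |y + ((-⌊y⌋ : ℤ) : ℝ)| ≤ 1 := by
      have h1 := Int.fract_nonneg y
      have h2 := (Int.fract_lt_one y).le
      unfold Int.fract at h1 h2
      push_cast
      rw [abs_le]; constructor <;> linarith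
    have e2 : |t + ((-⌊t⌋ : ℤ) : ℝ)| ≤ 1 := by
      have h1 := Int.fract_nonneg t
      have h2 := (Int.fract_lt_one t).le
      unfold Int.fract at h1 h2
      push_cast
      rw [abs_le]; constructor <;> linarith
    have e3 : ‖x' + intVec k‖ ≤ √n + (D + 1) := by
      have : x' + intVec k = (x + intVec k) - (x - x') := by abel
      rw [this]
      exact (norm_sub_le _ _).trans (add_le_add hk hX)
    have e4 : |t' + ((-⌊t⌋ : ℤ) : ℝ)| ≤ 1 + (D + 1) := by
      have : t' + ((-⌊t⌋ : ℤ) : ℝ) = (t + ((-⌊t⌋ : ℤ) : ℝ)) - (t - t') := by ring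
      rw [this]
      exact (abs_sub _ _).trans (add_le_add e2 hT)
    have e5 : |y' + ((-⌊y⌋ - σi * j : ℤ) : ℝ)| ≤ 1 + (P + 4 * B + 1) := by
      have : y' + ((-⌊y⌋ - σi * j : ℤ) : ℝ) = (y + ((-⌊y⌋ : ℤ) : ℝ)) + σ * (s - j) := by
        rw [hcast, hs]; push_cast
        linear_combination (-(y' - y)) * hσσ
      rw [this]
      refine (abs_add_le _ _).trans (add_le_add e1 ?_)
      rw [abs_mul, hσa, one_mul]; exact hj2
    have hn0 : 0 ≤ √(n : ℝ) := Real.sqrt_nonneg _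
    have : 0 ≤ P + 4 * B + 1 := by positivity
    rw [mem_closedBall_zero_iff]
    simp only [Prod.norm_def, Real.norm_eq_abs]
    refine max_le (max_le ?_ (max_le ?_ ?_)) (max_le ?_ (max_le ?_ ?_)) <;> linarith
  · simp only [Phi]
    rw [hup.int, hvp.int, hcast]
    have g1 : σ * (y' + (-(⌊y⌋ : ℝ) - σ * j) - (y + ((-⌊y⌋ : ℤ) : ℝ))) = s - j := by
      rw [hs]; push_cast; linear_combination (-(j : ℝ)) * hσσ
    have g2 : t + ((-⌊t⌋ : ℤ) : ℝ) - (t' + ((-⌊t⌋ : ℤ) : ℝ)) = t - t' := by ring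
    have g3 : x + intVec k - (x' + intVec k) = x - x' := by abel
    rw [g1, g2, g3, hj1]
    linarith

/-! ## Doubling of variables -/

lemma hasFDerivAt_sq {n : ℕ} (a : ℝ) (x x' : Euc n) :
    HasFDerivAt (fun w : Euc n => a * ‖w - x'‖ ^ 2) (innerSL ℝ ((2 * a) • (x - x'))) x := by
  have h1 : HasFDerivAt (fun w : Euc n => w - x') (ContinuousLinearMap.id ℝ (Euc n)) x :=
    (hasFDerivAt_id x).sub_const x'
  have h2 := (h1.norm_sq).const_mul a
  refine h2.congr_fderiv ?_
  ext v
  simp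
  ring

lemma phi_visc {n : ℕ} {G : Ham n} {u v : Dom n → ℝ} {P σ a b α lam mu : ℝ}
    (hu : ViscSub G α lam u) (hv : ViscSuper G α mu v) {Z : Dom n × Dom n}
    (hZ : ∀ Z', Phi u v P σ a b Z' ≤ Phi u v P σ a b Z) :
    2 * b * (Z.1.2.2 - Z.2.2.2) + G Z.1.1 Z.1.2.1 Z.1.2.2 ((2 * a) • (Z.1.1 - Z.2.1))
      (-(σ * P) + 2 * b * σ * max (-(σ * (Z.2.2.1 - Z.1.2.1))) 0) + α * u Z.1 ≤ lam ∧
    mu ≤ 2 * b * (Z.1.2.2 - Z.2.2.2) + G Z.2.1 Z.2.2.1 Z.2.2.2 ((2 * a) • (Z.1.1 - Z.2.1))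
      (-(σ * P) + 2 * b * σ * max (-(σ * (Z.2.2.1 - Z.1.2.1))) 0) + α * v Z.2 := by
  obtain ⟨⟨x, y, t⟩, ⟨x', y', t'⟩⟩ := Z
  dsimp only
  constructor
  · have hd1 := hasFDerivAt_sq a x x'
    have hd2 : HasDerivAt (fun w : ℝ => P * (σ * (y' - w)) + b * pp (-(σ * (y' - w))))
        (-(σ * P) + 2 * b * σ * max (-(σ * (y' - y))) 0) y := by
      have e1 : HasDerivAt (fun w : ℝ => σ * (y' - w)) (σ * (-1)) y :=
        ((hasDerivAt_id y).const_sub y').const_mul σ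
      have e1n : HasDerivAt (fun w : ℝ => -(σ * (y' - w))) (-(σ * (-1))) y := e1.neg
      have e2 : HasDerivAt (fun w : ℝ => pp (-(σ * (y' - w)))) _ y :=
        HasDerivAt.comp (h₂ := pp) y (pp_hasDerivAt (-(σ * (y' - y)))) e1n
      have e3 := (e1.const_mul P).add (e2.const_mul b)
      refine e3.congr_deriv ?_
      ring
    have hd3 : HasDerivAt (fun w : ℝ => b * (w - t') ^ 2) (2 * b * (t - t')) t := by
      have e1 := (((hasDerivAt_id t).sub_const t').pow 2).const_mul b
      refine e1.congr_deriv ?_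
      simp; ring
    have hsm : ContDiff ℝ 1 (fun w : Dom n => a * ‖w.1 - x'‖ ^ 2 +
        (P * (σ * (y' - w.2.1)) + b * pp (-(σ * (y' - w.2.1)))) + b * (w.2.2 - t') ^ 2) := by
      have h1 : ContDiff ℝ 1 (fun w : Dom n => ‖w.1 - x'‖ ^ 2) :=
        (contDiff_fst.sub contDiff_const).norm_sq ℝ
      have h2 : ContDiff ℝ 1 (fun w : Dom n => pp (-(σ * (y' - w.2.1)))) :=
        pp_contDiff.comp (by fun_prop)
      fun_prop
    have := hu.2 _ hsm (x, y, t) ?_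
    · have h := sep_hop G (z := (x, y, t)) hd1 hd2 hd3
      unfold hop at h
      rw [h] at this
      exact this
    · refine Filter.Eventually.of_forall fun w => ?_
      have h := hZ (w, (x', y', t'))
      simp only [Phi] at h
      dsimp only
      linarith
  · have hd1 : HasFDerivAt (fun w : Euc n => -a * ‖w - x‖ ^ 2)
        (innerSL ℝ ((2 * a) • (x - x'))) x' := by
      refine (hasFDerivAt_sq (-a) x' x).congr_fderiv ?_
      congr 1
      rw [← neg_sub x x', smul_neg, mul_neg, neg_smul, neg_neg]
    have hd2 : HasDerivAt (fun w : ℝ => -(P * (σ * (w - y))) - b * pp (-(σ * (w - y))))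
        (-(σ * P) + 2 * b * σ * max (-(σ * (y' - y))) 0) y' := by
      have e1 : HasDerivAt (fun w : ℝ => σ * (w - y)) (σ * 1) y' :=
        ((hasDerivAt_id y').sub_const y).const_mul σ
      have e1n : HasDerivAt (fun w : ℝ => -(σ * (w - y))) (-(σ * 1)) y' := e1.neg
      have e2 : HasDerivAt (fun w : ℝ => pp (-(σ * (w - y)))) _ y' :=
        HasDerivAt.comp (h₂ := pp) y' (pp_hasDerivAt (-(σ * (y' - y)))) e1n
      have e3 := (e1.const_mul P).neg.sub (e2.const_mul b)
      refine e3.congr_deriv ?_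
      ring
    have hd3 : HasDerivAt (fun w : ℝ => -b * (t - w) ^ 2) (2 * b * (t - t')) t' := by
      have e1 := (((hasDerivAt_id t').const_sub t).pow 2).const_mul (-b)
      refine e1.congr_deriv ?_
      simp; ring
    have hsm : ContDiff ℝ 1 (fun w : Dom n => -a * ‖w.1 - x‖ ^ 2 +
        (-(P * (σ * (w.2.1 - y))) - b * pp (-(σ * (w.2.1 - y)))) + -b * (t - w.2.2) ^ 2) := by
      have h1 : ContDiff ℝ 1 (fun w : Dom n => ‖w.1 - x‖ ^ 2) :=
        (contDiff_fst.sub contDiff_const).norm_sq ℝ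
      have h2 : ContDiff ℝ 1 (fun w : Dom n => pp (-(σ * (w.2.1 - y)))) :=
        pp_contDiff.comp (by fun_prop)
      fun_prop
    have := hv.2 _ hsm (x', y', t') ?_
    · have h := sep_hop G (z := (x', y', t')) hd1 hd2 hd3
      unfold hop at h
      rw [h] at this
      exact this
    · refine Filter.Eventually.of_forall fun w => ?_
      have h := hZ ((x, y, t), w)
      simp only [Phi] at h
      dsimp only
      rw [norm_sub_rev w.1 x, norm_sub_rev x' x]
      linarith

lemma phi_param {n : ℕ} {u v : Dom n → ℝ} {B P σ R : ℝ}
    (huB : ∀ z, |u z| ≤ B) (hvB : ∀ z, |v z| ≤ B)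
    (hmax : ∀ a b : ℝ, 1 ≤ a → 1 ≤ b → ∃ Z : Dom n × Dom n,
      ‖Z‖ ≤ R ∧ ∀ Z', Phi u v P σ a b Z' ≤ Phi u v P σ a b Z) {ε : ℝ} (hε : 0 < ε) :
    ∃ b a₀ : ℝ, 1 ≤ b ∧ 1 ≤ a₀ ∧ ∀ a, a₀ ≤ a → ∃ Z : Dom n × Dom n,
      ‖Z‖ ≤ R ∧ (∀ Z', Phi u v P σ a b Z' ≤ Phi u v P σ a b Z) ∧
      b * (pp (-(σ * (Z.2.2.1 - Z.1.2.1))) + (Z.1.2.2 - Z.2.2.2) ^ 2) ≤ ε ∧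
      (a - a₀) * ‖Z.1.1 - Z.2.1‖ ^ 2 ≤ ε := by
  set S : Set ℝ := {r | ∃ a b : ℝ, 1 ≤ a ∧ 1 ≤ b ∧ ∃ Z : Dom n × Dom n, r = Phi u v P σ a b Z ∧
    ∀ Z', Phi u v P σ a b Z' ≤ Phi u v P σ a b Z} with hS
  have hbd : BddBelow S := by
    refine ⟨-(2 * B), ?_⟩
    rintro r ⟨a, b, ha, hb, Z, rfl, hZ⟩
    refine le_trans ?_ (hZ 0)
    have h0 : Phi u v P σ a b 0 = u 0 - v 0 := by simp [Phi, pp]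
    rw [h0]
    have := abs_le.1 (huB 0)
    have := abs_le.1 (hvB 0)
    linarith
  have hne : S.Nonempty := by
    obtain ⟨Z, _, hZ⟩ := hmax 1 1 le_rfl le_rfl
    exact ⟨_, 1, 1, le_rfl, le_rfl, Z, rfl, hZ⟩
  obtain ⟨r, ⟨a₀, b₀, ha₀, hb₀, Z₀, rfl, hZ₀⟩, hr⟩ :=
    exists_lt_of_csInf_lt hne (show sInf S < sInf S + ε / 2 by linarith)
  refine ⟨2 * b₀, a₀, by linarith, ha₀, fun a ha => ?_⟩
  obtain ⟨Z, hZR, hZ⟩ := hmax a (2 * b₀) (ha₀.trans ha) (by linarith)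
  refine ⟨Z, hZR, hZ, ?_⟩
  have h1 : sInf S ≤ Phi u v P σ a (2 * b₀) Z :=
    csInf_le hbd ⟨a, 2 * b₀, ha₀.trans ha, by linarith, Z, rfl, hZ⟩
  have h2 := hZ₀ Z
  have h3 : Phi u v P σ a₀ b₀ Z = Phi u v P σ a (2 * b₀) Z
      + b₀ * (pp (-(σ * (Z.2.2.1 - Z.1.2.1))) + (Z.1.2.2 - Z.2.2.2) ^ 2)
      + (a - a₀) * ‖Z.1.1 - Z.2.1‖ ^ 2 := by
    simp only [Phi]; ring
  have h4 : 0 ≤ (a - a₀) * ‖Z.1.1 - Z.2.1‖ ^ 2 := mul_nonneg (by linarith) (by positivity)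
  have h5 : 0 ≤ b₀ * (pp (-(σ * (Z.2.2.1 - Z.1.2.1))) + (Z.1.2.2 - Z.2.2.2) ^ 2) := by
    unfold pp; positivity
  constructor <;> linarith

/-- The shifted Hamiltonian of the cell problem. -/
def cellH {n : ℕ} (F : Ham n) (px : Euc n) (py : ℝ) : Ham n :=
  fun x y t qx qy => F x y t (px + qx) (py + qy)

lemma unif_x {n : ℕ} {F : Ham n} (h1 : HypH1 F) (M : ℝ) {ε : ℝ} (hε : 0 < ε) :
    ∃ δ > 0, ∀ x x' y t p q, ‖x‖ ≤ M → ‖x'‖ ≤ M → |y| ≤ M → |t| ≤ M → ‖p‖ ≤ M → |q| ≤ M →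
      ‖x - x'‖ < δ → |F x' y t p q - F x y t p q| ≤ ε := by
  have hc := (isCompact_closedBall (0 : Xi n) M).uniformContinuousOn_of_continuous
    h1.1.continuousOn
  rw [Metric.uniformContinuousOn_iff] at hc
  obtain ⟨δ, hδ, h⟩ := hc ε hε
  refine ⟨δ, hδ, fun x x' y t p q hx hx' hy ht hp hq hd => ?_⟩
  have := h (x', y, t, p, q) ?_ (x, y, t, p, q) ?_ ?_
  · rw [Real.dist_eq] at this; exact this.le
  · rw [mem_closedBall_zero_iff]
    simp only [Prod.norm_def, Real.norm_eq_abs]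
    exact max_le hx' (max_le hy (max_le ht (max_le hp hq)))
  · rw [mem_closedBall_zero_iff]
    simp only [Prod.norm_def, Real.norm_eq_abs]
    exact max_le hx (max_le hy (max_le ht (max_le hp hq)))
  · simp only [Prod.dist_eq, dist_self]
    rw [dist_comm, dist_eq_norm]
    simpa using hd

set_option maxHeartbeats 1000000 in
lemma doubling {n : ℕ} {F : Ham n} {C₃ C₄ C₅ : ℝ}
    (h1 : HypH1 F) (h2 : HypH2' F) (h3 : HypH3 F 0 C₃ C₄ C₅) {px : Euc n} {py P σ : ℝ}
    (hσ : σ = 1 ∨ σ = -1) (hP : 0 ≤ P) (hpy : py = σ * P) {α lam mu B : ℝ} (hα : 0 ≤ α)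
    {u v : Dom n → ℝ} (hu : ViscSub (cellH F px py) α lam u)
    (hv : ViscSuper (cellH F px py) α mu v) (huB : ∀ z, |u z| ≤ B) (hvB : ∀ z, |v z| ≤ B)
    (hup : STPeriodic u) (hvp : STPeriodic v) {η : ℝ} (hη : 0 < η) :
    ∃ z z', α * (u z - v z') ≤ lam - mu + η ∧
      ∀ x y t h, 0 ≤ h → u (x, y, t) - v (x, y + σ * h, t) - P * h ≤ u z - v z' + η := by
  have hB : 0 ≤ B := (abs_nonneg _).trans (huB 0)
  have hC₃ := h3.1
  have hC₄ := h3.2.1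
  have hC₅ := h3.2.2.1
  have hσσ : σ * σ = 1 := by rcases hσ with h | h <;> rw [h] <;> norm_num
  have hσa : |σ| = 1 := by rcases hσ with h | h <;> rw [h] <;> norm_num
  obtain ⟨C₁, C₂, hC₁, hC₂, hF4⟩ := F4 h1 h2 h3
  obtain ⟨R, hR, hmax⟩ := phi_max hu.1 hv.1 huB hvB hup hvp hσ hP
  set A := |lam| + α * B + C₂ with hA
  have hA0 : 0 ≤ A := by positivity
  set Θ := 2 * C₃ + 2 * C₄ * (1 + A + (3 + C₅)) with hΘ
  have hΘ0 : 0 ≤ Θ := by positivity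
  obtain ⟨κ, hκ0, hκ1, hκ2, hκ3, hκ4⟩ : ∃ κ : ℝ, 0 < κ ∧ κ ≤ 1 ∧ C₄ * κ ≤ 1 / 2 ∧
      P * κ ≤ η ∧ Θ * κ ≤ η / 2 := by
    have key : ∀ c d : ℝ, 0 ≤ c → 0 < d → ∀ᶠ κ in 𝓝[>] (0 : ℝ), c * κ ≤ d := by
      intro c d hc hd
      have : Tendsto (fun κ : ℝ => c * κ) (𝓝[>] 0) (𝓝 (c * 0)) :=
        ((continuous_const.mul continuous_id).tendsto 0).mono_left nhdsWithin_le_nhds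
      rw [mul_zero] at this
      exact (this.eventually_lt_const hd).mono fun _ h => h.le
    have hpos : ∀ᶠ κ in 𝓝[>] (0 : ℝ), 0 < κ := eventually_mem_nhdsWithin
    obtain ⟨κ, a1, a2, a3, a4, a5⟩ := (hpos.and ((key 1 1 zero_le_one one_pos).and
      ((key C₄ (1 / 2) hC₄ (by norm_num)).and ((key P η hP hη).and
        (key Θ (η / 2) hΘ0 (by linarith)))))).exists
    exact ⟨κ, a1, by linarith, a3, a4, a5⟩
  have hκκ : κ ^ 2 ≤ κ := by nlinarith
  obtain ⟨b, a₀, hb, ha₀, hsel⟩ := phi_param huB hvB hmax (pow_pos hκ0 2)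
  set Rb := (A + (1 + C₅) * (2 * b * κ)) / C₁ with hRb
  have hRb0 : 0 ≤ Rb := by positivity
  obtain ⟨δ, hδ, hunif⟩ := unif_x h1 (R + Rb + 2 * b * κ) (half_pos hη)
  obtain ⟨Z, hZR, hZ, hQ, hX⟩ := hsel (a₀ + (κ / δ) ^ 2 + 1) (by linarith [sq_nonneg (κ / δ)])
  obtain ⟨hi, hii⟩ := phi_visc hu hv hZ
  obtain ⟨⟨x, y, t⟩, ⟨x', y', t'⟩⟩ := Z
  simp only [cellH] at *
  rw [show py + (-(σ * P) + 2 * b * σ * max (-(σ * (y' - y))) 0)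
    = 2 * b * σ * max (-(σ * (y' - y))) 0 by rw [hpy]; ring] at hi hii
  set q := px + (2 * (a₀ + (κ / δ) ^ 2 + 1)) • (x - x') with hq
  unfold pp at hQ
  have hm0 : 0 ≤ max (-(σ * (y' - y))) 0 := le_max_right _ _
  have hms : max (-(σ * (y' - y))) 0 * |y' - y| = max (-(σ * (y' - y))) 0 ^ 2 := by
    have e : |y' - y| = |σ * (y' - y)| := by rw [abs_mul, hσa, one_mul]
    rw [e]
    rcases le_total 0 (σ * (y' - y)) with h | h
    · rw [max_eq_right (by linarith)]; simp
    · rw [max_eq_left (by linarith), abs_of_nonpos h]; ring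
  have hPs : -(P * (σ * (y' - y))) ≤ P * max (-(σ * (y' - y))) 0 := by
    have := mul_le_mul_of_nonneg_left (le_max_left (-(σ * (y' - y))) 0) hP
    linarith
  have hra : |2 * b * σ * max (-(σ * (y' - y))) 0| = 2 * b * max (-(σ * (y' - y))) 0 := by
    rw [abs_mul, abs_mul, abs_mul, hσa, abs_of_nonneg hm0, abs_of_nonneg (by linarith : 0 ≤ b)]
    norm_num
  set r := 2 * b * σ * max (-(σ * (y' - y))) 0 with hr
  set m := max (-(σ * (y' - y))) 0 with hm
  set d := |t - t'| with hd
  have hd0 : 0 ≤ d := abs_nonneg _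
  have hdd : (t - t') ^ 2 = d ^ 2 := (sq_abs _).symm
  rw [hdd] at hQ
  have hbm : b * m ^ 2 + b * d ^ 2 ≤ κ ^ 2 := by linarith
  have hbm0 : 0 ≤ b * m ^ 2 := by positivity
  have hbd0 : 0 ≤ b * d ^ 2 := by positivity
  have hmκ : m ≤ κ := by
    have : m ^ 2 ≤ κ ^ 2 := by
      have : m ^ 2 ≤ b * m ^ 2 := le_mul_of_one_le_left (sq_nonneg m) hb
      linarith
    exact (pow_le_pow_iff_left₀ hm0 hκ0.le two_ne_zero).1 this
  have hdκ : d ≤ κ := by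
    have : d ^ 2 ≤ κ ^ 2 := by
      have : d ^ 2 ≤ b * d ^ 2 := le_mul_of_one_le_left (sq_nonneg d) hb
      linarith
    exact (pow_le_pow_iff_left₀ hd0 hκ0.le two_ne_zero).1 this
  have hτ : |2 * b * (t - t')| = 2 * b * d := by
    rw [abs_mul, abs_of_nonneg (by linarith : 0 ≤ 2 * b)]
  have hxδ : ‖x - x'‖ < δ := by
    by_contra hc
    push Not at hc
    have e1 : δ ^ 2 ≤ ‖x - x'‖ ^ 2 := by gcongr
    have e2 : (κ / δ) ^ 2 * δ ^ 2 = κ ^ 2 := by field_simp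
    have e3 : ((κ / δ) ^ 2 + 1) * δ ^ 2 ≤ ((κ / δ) ^ 2 + 1) * ‖x - x'‖ ^ 2 := by gcongr
    have e4 : 0 < δ ^ 2 := by positivity
    have e5 : a₀ + (κ / δ) ^ 2 + 1 - a₀ = (κ / δ) ^ 2 + 1 := by ring
    rw [e5] at hX
    linarith
  -- bound of `F` at the first point
  have huz := abs_le.1 (huB (x, y, t))
  have hFup : F x y t q r ≤ |lam| + α * B + 2 * b * d := by
    have e1 := le_abs_self lam
    have e2 := neg_abs_le (2 * b * (t - t'))
    have e3 : - (α * B) ≤ α * u (x, y, t) := by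
      have := mul_le_mul_of_nonneg_left huz.1 hα
      linarith
    rw [hτ] at e2
    linarith
  have hFlow := hF4 x y t q r
  rw [hra] at hFlow
  have hFabs : |F x y t q r| ≤ A + 2 * b * d + C₅ * (2 * b * m) := by
    have e1 : 0 ≤ C₁ * ‖q‖ := by positivity
    have e2 : 0 ≤ |lam| := abs_nonneg _
    have e3 : 0 ≤ α * B := by positivity
    have e4 : 0 ≤ 2 * b * d := by positivity
    have e5 : 0 ≤ C₅ * (2 * b * m) := by positivity
    rw [abs_le]; constructor <;> linarith
  have hqR : ‖q‖ ≤ Rb := by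
    rw [hRb, le_div_iff₀ hC₁]
    have e1 : 2 * b * d ≤ 2 * b * κ := by gcongr
    have e2 : C₅ * (2 * b * m) ≤ C₅ * (2 * b * κ) := by gcongr
    linarith
  have hrR : |r| ≤ 2 * b * κ := by rw [hra]; gcongr
  have hbκ : 0 ≤ 2 * b * κ := by positivity
  simp only [Prod.norm_def, Real.norm_eq_abs, max_le_iff] at hZR
  obtain ⟨⟨hx, hy, ht⟩, hx', hy', ht'⟩ := hZR
  have s1 : |F x y t' q r - F x y t q r| ≤ 2 * C₄ * d * (1 + |r| + |F x y t q r|) := by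
    have e : |t' - t| = d := abs_sub_comm _ _
    have := F2 h1 h3 x y t t' q r (by
      rw [e]; exact (mul_le_mul_of_nonneg_left hdκ hC₄).trans hκ2)
    rwa [e] at this
  have s2 : |F x y' t' q r - F x y t' q r| ≤ C₃ * |r| * |y' - y| := F1 h1 h3 ..
  have s3 := hunif x x' y' t' q r (by linarith) (by linarith) (by linarith) (by linarith)
    (by linarith) (by linarith) hxδ
  have t1 : 2 * C₄ * d * (1 + |r| + |F x y t q r|) ≤ 2 * C₄ * (1 + A + (3 + C₅)) * κ := by
    have hdb : d * (1 + |r| + |F x y t q r|) ≤ (1 + A + (3 + C₅)) * κ := by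
      have e0 : d * (1 + |r| + |F x y t q r|) ≤
          d * (1 + 2 * b * m + (A + 2 * b * d + C₅ * (2 * b * m))) := by
        rw [hra]; gcongr
      have e1 : 2 * (b * (m * d)) ≤ κ ^ 2 := by
        have : 0 ≤ b * (m - d) ^ 2 := by positivity
        linarith
      have e2 : b * d ^ 2 ≤ κ ^ 2 := by linarith
      have e3 : (1 + C₅) * (2 * (b * (m * d))) ≤ (1 + C₅) * κ := by
        gcongr; linarith
      have e4 : (1 + A) * d ≤ (1 + A) * κ := by gcongr
      have e5 : d * (1 + 2 * b * m + (A + 2 * b * d + C₅ * (2 * b * m))) =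
        (1 + A) * d + (1 + C₅) * (2 * (b * (m * d))) + 2 * (b * d ^ 2) := by ring
      linarith
    calc _ = 2 * C₄ * (d * (1 + |r| + |F x y t q r|)) := by ring
      _ ≤ 2 * C₄ * ((1 + A + (3 + C₅)) * κ) := by gcongr
      _ = _ := by ring
  have t2 : C₃ * |r| * |y' - y| ≤ 2 * C₃ * κ := by
    have : C₃ * |r| * |y' - y| = 2 * C₃ * (b * m ^ 2) := by
      rw [hra, ← hms]; ring
    rw [this]
    gcongr
    linarith
  have hdiff : F x' y' t' q r - F x y t q r ≤ η := by
    have e1 := (le_abs_self _).trans (s1.trans t1)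
    have e2 := (le_abs_self _).trans (s2.trans t2)
    have e3 := (le_abs_self _).trans s3
    have e4 : Θ * κ = 2 * C₃ * κ + 2 * C₄ * (1 + A + (3 + C₅)) * κ := by rw [hΘ]; ring
    linarith
  refine ⟨(x, y, t), (x', y', t'), by linarith, fun X Y T h hh => ?_⟩
  have hk := hZ ((X, Y, T), (X, Y + σ * h, T))
  simp only [Phi] at hk
  have e1 : σ * (Y + σ * h - Y) = h := by linear_combination h * hσσ
  rw [e1] at hk
  have e2 : pp (-h) = 0 := by unfold pp; rw [max_eq_right (by linarith)]; ring
  rw [e2] at hk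
  simp only [sub_self, norm_zero] at hk
  have e3 : 0 ≤ b * (pp (-(σ * (y' - y))) + (t - t') ^ 2) := by unfold pp; positivity
  have e4 : 0 ≤ (a₀ + (κ / δ) ^ 2 + 1) * ‖x - x'‖ ^ 2 := by positivity
  have e5 : P * m ≤ P * κ := by gcongr
  linarith

/-! ## Consequences of the doubling lemma -/

lemma exists_sign (py : ℝ) : ∃ σ : ℝ, (σ = 1 ∨ σ = -1) ∧ py = σ * |py| := by
  rcases le_total 0 py with h | h
  · exact ⟨1, Or.inl rfl, by rw [abs_of_nonneg h]; ring⟩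
  · exact ⟨-1, Or.inr rfl, by rw [abs_of_nonpos h]; ring⟩

lemma cell_compare {n : ℕ} {F : Ham n} {C₃ C₄ C₅ : ℝ}
    (h1 : HypH1 F) (h2 : HypH2' F) (h3 : HypH3 F 0 C₃ C₄ C₅) {px : Euc n} {py lam mu : ℝ}
    {u v : Dom n → ℝ} (hu : ViscSub (cellH F px py) 0 lam u)
    (hv : ViscSuper (cellH F px py) 0 mu v) (huB : Bdd u) (hvB : Bdd v)
    (hup : STPeriodic u) (hvp : STPeriodic v) : mu ≤ lam := by
  obtain ⟨σ, hσ, hpy⟩ := exists_sign py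
  obtain ⟨M, hM⟩ := huB
  obtain ⟨M', hM'⟩ := hvB
  refine le_of_forall_pos_le_add fun η hη => ?_
  obtain ⟨z, z', h, -⟩ := doubling h1 h2 h3 hσ (abs_nonneg py) hpy (B := max M M') le_rfl hu hv
    (fun z => (hM z).trans (le_max_left _ _)) (fun z => (hM' z).trans (le_max_right _ _))
    hup hvp hη
  linarith

lemma disc_compare {n : ℕ} {F : Ham n} {C₃ C₄ C₅ : ℝ}
    (h1 : HypH1 F) (h2 : HypH2' F) (h3 : HypH3 F 0 C₃ C₄ C₅) {px : Euc n} {py σ : ℝ}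
    (hσ : σ = 1 ∨ σ = -1) (hpy : py = σ * |py|) {α B : ℝ} (hα : 0 < α)
    {u v : Dom n → ℝ} (hu : ViscSub (cellH F px py) α 0 u)
    (hv : ViscSuper (cellH F px py) α 0 v) (huB : ∀ z, |u z| ≤ B) (hvB : ∀ z, |v z| ≤ B)
    (hup : STPeriodic u) (hvp : STPeriodic v) (x : Euc n) (y t : ℝ) {h : ℝ} (hh : 0 ≤ h) :
    u (x, y, t) - v (x, y + σ * h, t) ≤ |py| * h := by
  refine le_of_forall_pos_le_add fun ε hε => ?_
  have hη : 0 < ε / (1 / α + 1) := by positivity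
  obtain ⟨z, z', ha, hb⟩ := doubling h1 h2 h3 hσ (abs_nonneg py) hpy hα.le hu hv
    huB hvB hup hvp hη
  have hb' := hb x y t h hh
  set η := ε / (1 / α + 1) with hηd
  have e1 : u z - v z' ≤ η / α := by
    rw [le_div_iff₀ hα]; linarith
  have e2 : η / α + η = ε := by
    rw [hηd]; field_simp
  linarith

/-- Solutions of the discounted problem. -/
lemma disc_sol {n : ℕ} {F : Ham n} {C₃ C₄ C₅ : ℝ}
    (h1 : HypH1 F) (h2 : HypH2' F) (h3 : HypH3 F 0 C₃ C₄ C₅) (px : Euc n) (py : ℝ)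
    {α K₀ : ℝ} (hα : 0 < α) (hK : ∀ x y t, |F x y t px py| ≤ K₀) :
    ∃ w : Dom n → ℝ, Continuous w ∧ STPeriodic w ∧ ViscSub (cellH F px py) α 0 w ∧
      ViscSuper (cellH F px py) α 0 w ∧ (∀ z, |w z| ≤ K₀ / α) ∧
      ∀ x y y' t, w (x, y, t) ≤ w (x, y', t) + |py| := by
  have hcont : HCont (cellH F px py) := by
    unfold HCont cellH
    exact h1.1.comp (f := fun ξ : Xi n =>
      ((ξ.1, ξ.2.1, ξ.2.2.1, px + ξ.2.2.2.1, py + ξ.2.2.2.2) : Xi n)) (by fun_prop)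
  obtain ⟨w, v, hw, hv, hwN, hvN, hvw, hper⟩ := perron hcont hα (N := K₀ / α) (by
    intro x y t
    have : α * (K₀ / α) = K₀ := by field_simp
    simp only [cellH, add_zero, this]; exact hK x y t)
  have sx : ∀ k : Fin n → ℤ, HShift (cellH F px py) (intVec k, 0, 0) := by
    intro k x y t p q; simp only [cellH, add_zero]; exact h1.2.1 ..
  have sy : HShift (cellH F px py) (0, 1, 0) := by
    intro x y t p q; simp only [cellH, add_zero]; exact h1.2.2.1 ..
  have st : HShift (cellH F px py) (0, 0, 1) := by
    intro x y t p q; simp only [cellH, add_zero]; exact h1.2.2.2 ..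
  have hwp : STPeriodic w := by
    refine ⟨fun k x y t => ?_, fun x y t => ?_, fun x y t => ?_⟩
    · simpa using (hper _ (sx k)).1 (x, y, t)
    · simpa using (hper _ sy).1 (x, y, t)
    · simpa using (hper _ st).1 (x, y, t)
  have hvp : STPeriodic v := by
    refine ⟨fun k x y t => ?_, fun x y t => ?_, fun x y t => ?_⟩
    · simpa using (hper _ (sx k)).2 (x, y, t)
    · simpa using (hper _ sy).2 (x, y, t)
    · simpa using (hper _ st).2 (x, y, t)
  obtain ⟨σ, hσ, hpy⟩ := exists_sign py
  have hcmp := fun x y t h hh =>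
    disc_compare h1 h2 h3 hσ hpy hα hw hv hwN hvN hwp hvp x y t (h := h) hh
  have heq : v = w := by
    funext z
    refine le_antisymm (hvw z) ?_
    have := hcmp z.1 z.2.1 z.2.2 0 le_rfl
    simpa using this
  subst heq
  refine ⟨v, ?_, hwp, hw, hv, hwN, ?_⟩
  · rw [continuous_iff_lower_upperSemicontinuous]
    exact ⟨hv.1, hw.1⟩
  · intro x y y' t
    have hσσ : σ * σ = 1 := by rcases hσ with h | h <;> rw [h] <;> norm_num
    have f0 := Int.fract_nonneg (σ * (y' - y))
    have f1 := (Int.fract_lt_one (σ * (y' - y))).le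
    have h := hcmp x y t (Int.fract (σ * (y' - y))) f0
    obtain ⟨σi, hσi⟩ : ∃ σi : ℤ, (σi : ℝ) = σ := by
      rcases hσ with h | h
      · exact ⟨1, by rw [h]; simp⟩
      · exact ⟨-1, by rw [h]; simp⟩
    have e : y + σ * Int.fract (σ * (y' - y)) = y' + ((-(σi * ⌊σ * (y' - y)⌋) : ℤ) : ℝ) := by
      unfold Int.fract
      push_cast
      rw [hσi]
      linear_combination (y' - y) * hσσ
    have e2 : v (x, y' + ((-(σi * ⌊σ * (y' - y)⌋) : ℤ) : ℝ), t) = v (x, y', t) := by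
      have := hwp.int 0 (-(σi * ⌊σ * (y' - y)⌋)) 0 x y' t
      have e0 : intVec (0 : Fin n → ℤ) = 0 := by ext i; simp [intVec]
      rw [e0] at this
      simpa using this
    rw [e, e2] at h
    have := mul_le_mul_of_nonneg_left f1 (abs_nonneg py)
    linarith

/-! ## Oscillation bound -/

lemma osc_hop {n : ℕ} (G : Ham n) (κ Λ A t0 t1 : ℝ) (x0 e : Euc n) (z : Dom n) :
    hop G (fun w : Dom n => κ * (w.2.2 - t0) + Λ * pp (w.2.2 - t1)
      + A * ‖w.1 - x0 - (w.2.2 - t0) • e‖ ^ 2) z =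
    κ + Λ * (2 * max (z.2.2 - t1) 0)
      - inner ℝ ((2 * A) • (z.1 - x0 - (z.2.2 - t0) • e)) e +
    G z.1 z.2.1 z.2.2 ((2 * A) • (z.1 - x0 - (z.2.2 - t0) • e)) 0 := by
  have ht : HasFDerivAt (fun w : Dom n => w.2.2)
      ((ContinuousLinearMap.snd ℝ ℝ ℝ).comp (ContinuousLinearMap.snd ℝ (Euc n) (ℝ × ℝ))) z :=
    hasFDerivAt_snd.comp z hasFDerivAt_snd
  have hx : HasFDerivAt (fun w : Dom n => w.1) (ContinuousLinearMap.fst ℝ (Euc n) (ℝ × ℝ)) z :=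
    hasFDerivAt_fst
  have a1 : HasFDerivAt (fun w : Dom n => κ * (w.2.2 - t0)) _ z := (ht.sub_const t0).const_mul κ
  have a2 : HasFDerivAt (fun w : Dom n => Λ * pp (w.2.2 - t1)) _ z :=
    (HasDerivAt.comp_hasFDerivAt (h₂ := pp) z (pp_hasDerivAt (z.2.2 - t1))
      (ht.sub_const t1)).const_mul Λ
  have a3 : HasFDerivAt (fun w : Dom n => w.1 - x0 - (w.2.2 - t0) • e) _ z :=
    (hx.sub_const x0).sub ((ht.sub_const t0).smul_const e)
  have a4 := (a3.norm_sq).const_mul A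
  have a5 : HasFDerivAt (fun w : Dom n => κ * (w.2.2 - t0) + Λ * pp (w.2.2 - t1)
      + A * ‖w.1 - x0 - (w.2.2 - t0) • e‖ ^ 2) _ z := (a1.add a2).add a4
  rw [hop_eq G a5 ((2 * A) • (z.1 - x0 - (z.2.2 - t0) • e)) (by
    intro v; simp [inner_smul_left, inner_sub_left]; ring)]
  simp [inner_smul_left, inner_sub_left]
  ring

lemma osc_contDiff {n : ℕ} (κ Λ A t0 t1 : ℝ) (x0 e : Euc n) :
    ContDiff ℝ 1 (fun w : Dom n => κ * (w.2.2 - t0) + Λ * pp (w.2.2 - t1)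
      + A * ‖w.1 - x0 - (w.2.2 - t0) • e‖ ^ 2) := by
  have h1 : ContDiff ℝ 1 (fun w : Dom n => ‖w.1 - x0 - (w.2.2 - t0) • e‖ ^ 2) :=
    ContDiff.norm_sq ℝ (by fun_prop)
  have h2 : ContDiff ℝ 1 (fun w : Dom n => pp (w.2.2 - t1)) := pp_contDiff.comp (by fun_prop)
  fun_prop

set_option maxHeartbeats 1000000 in
lemma osc_step {n : ℕ} {F : Ham n} {px : Euc n} {py C₁ C₂ K₀ α N : ℝ}
    (hC₁ : 0 < C₁) (hC₂ : 0 < C₂) (hK₀ : 0 ≤ K₀)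
    (hF : ∀ x y t p, C₁ * ‖p‖ - C₂ ≤ F x y t p py)
    {w : Dom n → ℝ} (hc : Continuous w) (hper : STPeriodic w)
    (hsub : ViscSub (cellH F px py) α 0 w) (hαw : ∀ z, |α * w z| ≤ K₀) (hN : ∀ z, |w z| ≤ N)
    (hosc : ∀ x y y' t, w (x, y, t) ≤ w (x, y', t) + |py|)
    {x0 x1 : Euc n} {y0 y1 t0 t1 : ℝ} (ht : t0 < t1) (hx : ‖x1 - x0‖ ≤ C₁ * (t1 - t0)) :
    w (x1, y1, t1) ≤ w (x0, y0, t0) + 1 + |py| + (K₀ + C₂ + C₁ * ‖px‖ + 1) * (t1 - t0) := by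
  have hN0 : 0 ≤ N := (abs_nonneg _).trans (hN 0)
  have htt : 0 < t1 - t0 := sub_pos.2 ht
  set K := K₀ + C₂ + C₁ * ‖px‖ with hKd
  have hK0 : 0 ≤ K := by positivity
  set e : Euc n := (t1 - t0)⁻¹ • (x1 - x0) with he
  have heC : ‖e‖ ≤ C₁ := by
    rw [he, norm_smul, norm_inv, Real.norm_eq_abs, abs_of_pos htt, inv_mul_le_iff₀ htt]
    linarith
  have hee : x1 - x0 - (t1 - t0) • e = 0 := by
    rw [he, smul_smul, mul_inv_cancel₀ htt.ne', one_smul, sub_self]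
  -- continuity at the base point
  obtain ⟨δ, hδ, hδw⟩ : ∃ δ > 0, ∀ x : Euc n, ‖x - x0‖ < δ →
      w (x, y0, t0) ≤ w (x0, y0, t0) + 1 := by
    have hcx : Continuous (fun x : Euc n => w (x, y0, t0)) := by fun_prop
    obtain ⟨δ, hδ, h⟩ := Metric.continuous_iff.1 hcx x0 1 one_pos
    refine ⟨δ, hδ, fun x hx => ?_⟩
    have := h x (by rwa [dist_eq_norm])
    rw [Real.dist_eq] at this
    have := (abs_lt.1 this).2
    linarith
  set A := 2 * N / δ ^ 2 + 1 with hA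
  have hA1 : 1 ≤ A := by rw [hA]; linarith [show 0 ≤ 2 * N / δ ^ 2 by positivity]
  have hAδ : 2 * N ≤ A * δ ^ 2 := by
    have : 2 * N / δ ^ 2 * δ ^ 2 = 2 * N := by field_simp
    nlinarith [sq_nonneg δ]
  set Λ := 2 * N + 1 with hΛ
  set φ : Dom n → ℝ := fun w : Dom n => (K + 1) * (w.2.2 - t0) + Λ * pp (w.2.2 - t1)
      + A * ‖w.1 - x0 - (w.2.2 - t0) • e‖ ^ 2 with hφ
  have hφc : ContDiff ℝ 1 φ := osc_contDiff _ _ _ _ _ _ _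
  set ρ := 2 * N + 1 with hρ
  set S : Set (Dom n) := Metric.closedBall x0 (ρ + (t1 + 1 - t0) * ‖e‖) ×ˢ
    (Set.Icc 0 1 ×ˢ Set.Icc t0 (t1 + 1)) with hS
  have hScpt : IsCompact S :=
    (isCompact_closedBall _ _).prod (isCompact_Icc.prod isCompact_Icc)
  have hρ0 : 0 ≤ ρ := by positivity
  have hbase : (x0, (0 : ℝ), t0) ∈ S := by
    refine ⟨Metric.mem_closedBall_self ?_, ⟨le_rfl, zero_le_one⟩, le_rfl, by linarith⟩
    have : 0 ≤ (t1 + 1 - t0) * ‖e‖ := mul_nonneg (by linarith) (norm_nonneg _)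
    linarith
  obtain ⟨Z, hZS, hZmax⟩ := hScpt.exists_isMaxOn ⟨_, hbase⟩
    (f := fun z => w z - φ z) (hc.sub hφc.continuous).continuousOn
  have hfb : w (x0, 0, t0) - φ (x0, 0, t0) = w (x0, 0, t0) := by
    have : max (t0 - t1) 0 = 0 := max_eq_right (by linarith)
    simp [hφ, pp, this]
  have hZb : -N ≤ w Z - φ Z := by
    have := hZmax hbase
    simp only [Set.mem_setOf_eq] at this
    rw [hfb] at this
    exact (abs_le.1 (hN _)).1.trans this
  have hφpos : ∀ z : Dom n, t0 ≤ z.2.2 → A * ‖z.1 - x0 - (z.2.2 - t0) • e‖ ^ 2 ≤ φ z := by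
    intro z hz
    have e1 : 0 ≤ (K + 1) * (z.2.2 - t0) := mul_nonneg (by linarith) (by linarith)
    have e2 : 0 ≤ Λ * pp (z.2.2 - t1) := by unfold pp; positivity
    simp only [hφ]; linarith
  have hglob : ∀ z : Dom n, t0 ≤ z.2.2 → z.2.2 ≤ t1 + 1 → w z - φ z ≤ w Z - φ Z := by
    rintro ⟨x, y, t⟩ hz1 hz2
    dsimp only at hz1 hz2
    by_cases hin : ‖x - x0 - (t - t0) • e‖ ≤ ρ
    · have hmem : (x, Int.fract y, t) ∈ S := by
        refine ⟨?_, ⟨Int.fract_nonneg _, (Int.fract_lt_one _).le⟩, hz1, hz2⟩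
        rw [Metric.mem_closedBall, dist_eq_norm]
        have : x - x0 = (x - x0 - (t - t0) • e) + (t - t0) • e := by abel
        rw [this]
        refine (norm_add_le _ _).trans (add_le_add hin ?_)
        rw [norm_smul, Real.norm_eq_abs, abs_of_nonneg (by linarith)]
        gcongr
      have h := hZmax hmem
      simp only [Set.mem_setOf_eq] at h
      have e1 : w (x, Int.fract y, t) = w (x, y, t) := by
        have := hper.int 0 (-⌊y⌋) 0 x y t
        have e0 : intVec (0 : Fin n → ℤ) = 0 := by ext i; simp [intVec]
        rw [e0] at this
        simpa [Int.fract, sub_eq_add_neg] using this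
      have e2 : φ (x, Int.fract y, t) = φ (x, y, t) := rfl
      rw [e1, e2] at h
      exact h
    · push Not at hin
      have h := hφpos (x, y, t) hz1
      dsimp only at h
      have e1 : ρ ^ 2 ≤ ‖x - x0 - (t - t0) • e‖ ^ 2 := by gcongr
      have e2 : ‖x - x0 - (t - t0) • e‖ ^ 2 ≤ A * ‖x - x0 - (t - t0) • e‖ ^ 2 :=
        le_mul_of_one_le_left (sq_nonneg _) hA1
      have e3 : 2 * N ≤ ρ ^ 2 := by rw [hρ]; nlinarith
      have e4 := (abs_le.1 (hN (x, y, t))).2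
      linarith
  have hZt := hZS.2.2
  have hZ0 : Z.2.2 = t0 := by
    by_contra hne
    have hgt : t0 < Z.2.2 := lt_of_le_of_ne hZt.1 (Ne.symm hne)
    have hlt : Z.2.2 < t1 + 1 := by
      by_contra hge
      push Not at hge
      have hZe : Z.2.2 = t1 + 1 := le_antisymm hZt.2 hge
      have e1 : 0 ≤ A * ‖Z.1 - x0 - (Z.2.2 - t0) • e‖ ^ 2 := by positivity
      have e2 : 0 ≤ (K + 1) * (Z.2.2 - t0) := mul_nonneg (by linarith) (by linarith)
      have e3 : pp (Z.2.2 - t1) = 1 := by rw [hZe]; simp [pp]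
      have e4 : φ Z = (K + 1) * (Z.2.2 - t0) + Λ * pp (Z.2.2 - t1)
        + A * ‖Z.1 - x0 - (Z.2.2 - t0) • e‖ ^ 2 := rfl
      rw [e3] at e4
      have e5 := (abs_le.1 (hN Z)).2
      linarith
    have hloc : IsLocalMax (fun z => w z - φ z) Z := by
      have hct : Continuous (fun z : Dom n => z.2.2) := by fun_prop
      filter_upwards [hct.continuousAt.eventually (lt_mem_nhds hgt),
        hct.continuousAt.eventually (gt_mem_nhds hlt)] with z hz1 hz2
      exact hglob z hz1.le hz2.le
    have hv := hsub.2 φ hφc Z hloc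
    have hh := osc_hop (cellH F px py) (K + 1) Λ A t0 t1 x0 e Z
    unfold hop at hh
    rw [hh] at hv
    simp only [cellH, add_zero] at hv
    set g := (2 * A) • (Z.1 - x0 - (Z.2.2 - t0) • e) with hg
    have e1 := hF Z.1 Z.2.1 Z.2.2 (px + g)
    have e2 : ‖g‖ ≤ ‖px + g‖ + ‖px‖ := by
      have : g = (px + g) - px := by abel
      calc ‖g‖ = ‖(px + g) - px‖ := by rw [← this]
        _ ≤ _ := norm_sub_le _ _
    have e3 := mul_le_mul_of_nonneg_left e2 hC₁.le
    have e4 : inner ℝ g e ≤ C₁ * ‖g‖ := by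
      refine (real_inner_le_norm g e).trans ?_
      rw [mul_comm]; gcongr
    have e5 : 0 ≤ Λ * (2 * max (Z.2.2 - t1) 0) :=
      mul_nonneg (by positivity) (mul_nonneg zero_le_two (le_max_right _ _))
    have e6 := (abs_le.1 (hαw Z)).1
    linarith
  have h1 := hglob (x1, y1, t1) ht.le (by dsimp only; linarith)
  have h2 : φ (x1, y1, t1) = (K + 1) * (t1 - t0) := by
    simp only [hφ]; rw [hee]; simp [pp]
  have h3 : φ Z = A * ‖Z.1 - x0‖ ^ 2 := by
    have : max (t0 - t1) 0 = 0 := max_eq_right (by linarith)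
    simp [hφ, pp, hZ0, this]
  rw [h2, h3] at h1
  have h4 : w Z ≤ w (Z.1, y0, t0) + |py| := by
    have : Z = (Z.1, Z.2.1, t0) := by rw [← hZ0]
    rw [this]; exact hosc _ _ _ _
  by_cases hd : ‖Z.1 - x0‖ < δ
  · have := hδw Z.1 hd
    have : 0 ≤ A * ‖Z.1 - x0‖ ^ 2 := by positivity
    linarith
  · push Not at hd
    have e1 : A * δ ^ 2 ≤ A * ‖Z.1 - x0‖ ^ 2 := by gcongr
    have e2 := (abs_le.1 (hN (Z.1, y0, t0))).2
    have e3 := (abs_le.1 (hN (x0, y0, t0))).1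
    linarith

lemma osc_bound {n : ℕ} {F : Ham n} {px : Euc n} {py C₁ C₂ K₀ α N : ℝ}
    (hC₁ : 0 < C₁) (hC₂ : 0 < C₂) (hK₀ : 0 ≤ K₀)
    (hF : ∀ x y t p, C₁ * ‖p‖ - C₂ ≤ F x y t p py)
    {w : Dom n → ℝ} (hc : Continuous w) (hper : STPeriodic w)
    (hsub : ViscSub (cellH F px py) α 0 w) (hαw : ∀ z, |α * w z| ≤ K₀) (hN : ∀ z, |w z| ≤ N)
    (hosc : ∀ x y y' t, w (x, y, t) ≤ w (x, y', t) + |py|) (z1 z0 : Dom n) :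
    w z1 ≤ w z0 + (1 + |py| + (K₀ + C₂ + C₁ * ‖px‖ + 1) * (√n / C₁ + 1)) := by
  obtain ⟨x1, y1, t1⟩ := z1
  obtain ⟨x0, y0, t0⟩ := z0
  set T := √n / C₁ with hT
  have hT0 : 0 ≤ T := by positivity
  obtain ⟨k, hk⟩ := exists_intVec (x1 - x0)
  have e1 := Int.floor_le (T - (t1 - t0))
  have e2 := Int.lt_floor_add_one (T - (t1 - t0))
  have hp := hper.int k 0 (⌊T - (t1 - t0)⌋ + 1) x1 y1 t1
  push_cast at hp
  have hTC : C₁ * T = √n := by rw [hT]; field_simp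
  have := osc_step hC₁ hC₂ hK₀ hF hc hper hsub hαw hN hosc (x0 := x0) (x1 := x1 + intVec k)
    (y0 := y0) (y1 := y1 + 0) (t0 := t0) (t1 := t1 + (⌊T - (t1 - t0)⌋ + 1)) (by linarith) (by
      have : x1 + intVec k - x0 = x1 - x0 + intVec k := by abel
      rw [this]
      refine hk.trans ?_
      rw [← hTC]
      gcongr
      linarith)
  rw [hp] at this
  have hK : 0 ≤ K₀ + C₂ + C₁ * ‖px‖ + 1 := by positivity
  have e3 := mul_le_mul_of_nonneg_left
    (show t1 + (⌊T - (t1 - t0)⌋ + 1) - t0 ≤ T + 1 by linarith) hK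
  linarith

/-! ## Conclusion -/

lemma per_bdd {n : ℕ} {g : Dom n → ℝ} (hg : Continuous g) (hp : STPeriodic g) :
    ∃ K, ∀ z, |g z| ≤ K := by
  obtain ⟨K, hK⟩ := (isCompact_closedBall (0 : Dom n) (√n + 1)).exists_bound_of_continuousOn
    hg.continuousOn
  refine ⟨K, ?_⟩
  rintro ⟨x, y, t⟩
  obtain ⟨k, hk⟩ := exists_intVec x
  have h := hp.int k (-⌊y⌋) (-⌊t⌋) x y t
  rw [← h, ← Real.norm_eq_abs]
  apply hK
  have e : ∀ s : ℝ, |s + ((-⌊s⌋ : ℤ) : ℝ)| ≤ 1 := by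
    intro s
    have h1 := Int.fract_nonneg s
    have h2 := (Int.fract_lt_one s).le
    unfold Int.fract at h1 h2
    push_cast
    rw [abs_le]; constructor <;> linarith
  have hn0 : 0 ≤ √(n : ℝ) := Real.sqrt_nonneg _
  rw [mem_closedBall_zero_iff]
  simp only [Prod.norm_def, Real.norm_eq_abs]
  have := e y
  have := e t
  refine max_le ?_ (max_le ?_ ?_) <;> linarith

lemma zero_periodic {n : ℕ} : STPeriodic (fun _ : Dom n => (0 : ℝ)) :=
  ⟨fun _ _ _ _ => rfl, fun _ _ _ => rfl, fun _ _ _ => rfl⟩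

lemma zero_bdd {n : ℕ} : Bdd (fun _ : Dom n => (0 : ℝ)) := ⟨0, fun _ => by simp⟩

lemma cell_zero_sub {n : ℕ} {F : Ham n} {px : Euc n} {py c : ℝ} (h : ∀ x y t, F x y t px py ≤ c) :
    ViscSub (cellH F px py) 0 c (fun _ => 0) := by
  refine ⟨upperSemicontinuous_const, fun φ hφ z hz => ?_⟩
  have hd : fderiv ℝ φ z = 0 := by
    apply IsLocalMin.fderiv_eq_zero
    filter_upwards [hz] with w hw
    linarith
  have h1 : pdX φ z = 0 := by unfold pdX; rw [hd]; ext i; simp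
  have h2 : pdY φ z = 0 := by unfold pdY; rw [hd]; simp
  have h3 : pdT φ z = 0 := by unfold pdT; rw [hd]; simp
  rw [h1, h2, h3]
  simpa [cellH] using h z.1 z.2.1 z.2.2

lemma cell_zero_super {n : ℕ} {F : Ham n} {px : Euc n} {py c : ℝ} (h : ∀ x y t, c ≤ F x y t px py) :
    ViscSuper (cellH F px py) 0 c (fun _ => 0) := by
  refine ⟨lowerSemicontinuous_const, fun φ hφ z hz => ?_⟩
  have hd : fderiv ℝ φ z = 0 := by
    apply IsLocalMax.fderiv_eq_zero
    filter_upwards [hz] with w hw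
    linarith
  have h1 : pdX φ z = 0 := by unfold pdX; rw [hd]; ext i; simp
  have h2 : pdY φ z = 0 := by unfold pdY; rw [hd]; simp
  have h3 : pdT φ z = 0 := by unfold pdT; rw [hd]; simp
  rw [h1, h2, h3]
  simpa [cellH] using h z.1 z.2.1 z.2.2

lemma fderiv_shift_const {n : ℕ} {G : Ham n} {α C c : ℝ} (hα : 0 ≤ α) {w : Dom n → ℝ}
    (hC : ∀ z, |w z - c| ≤ C) (hsub : ViscSub G α 0 w) :
    ViscSub G 0 (-(α * c) + α * C) (fun z => w z - c) := by
  refine ⟨?_, fun φ hφ z hz => ?_⟩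
  · intro z d hd
    have := hsub.1 z (d + c) (by linarith)
    filter_upwards [this] with y hy
    linarith
  · have h := hsub.2 φ hφ z (by
      filter_upwards [hz] with y hy
      linarith)
    have e := mul_le_mul_of_nonneg_left (abs_le.1 (hC z)).1 hα
    nlinarith

lemma super_shift_const {n : ℕ} {G : Ham n} {α C c : ℝ} (hα : 0 ≤ α) {w : Dom n → ℝ}
    (hC : ∀ z, |w z - c| ≤ C) (hsup : ViscSuper G α 0 w) :
    ViscSuper G 0 (-(α * c) - α * C) (fun z => w z - c) := by
  refine ⟨?_, fun φ hφ z hz => ?_⟩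
  · intro z d hd
    have := hsup.1 z (d + c) (by linarith)
    filter_upwards [this] with y hy
    linarith
  · have h := hsup.2 φ hφ z (by
      filter_upwards [hz] with y hy
      linarith)
    have e := mul_le_mul_of_nonneg_left (abs_le.1 (hC z)).2 hα
    nlinarith

lemma hls_periodic {n : ℕ} {u : ℕ → Dom n → ℝ} (h : ∀ k, STPeriodic (u k)) :
    STPeriodic (hls atTop u) := by
  refine ⟨fun k x y t => ?_, fun x y t => ?_, fun x y t => ?_⟩
  · have e := hls_shift (l := atTop) (u := u) (intVec k, 0, 0) (x, y, t)
    have e2 : (fun i w => u i (w + (intVec k, 0, 0))) = u := by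
      funext i ⟨x, y, t⟩
      simpa using (h i).1 k x y t
    rw [e2] at e
    simpa using e
  · have e := hls_shift (l := atTop) (u := u) (0, 1, 0) (x, y, t)
    have e2 : (fun i w => u i (w + (0, 1, 0))) = u := by
      funext i ⟨x, y, t⟩
      simpa using (h i).2.1 x y t
    rw [e2] at e
    simpa using e
  · have e := hls_shift (l := atTop) (u := u) (0, 0, 1) (x, y, t)
    have e2 : (fun i w => u i (w + (0, 0, 1))) = u := by
      funext i ⟨x, y, t⟩
      simpa using (h i).2.2 x y t
    rw [e2] at e
    simpa using e

lemma ViscSub.mono_lam {n : ℕ} {G : Ham n} {α lam mu : ℝ} {u : Dom n → ℝ}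
    (h : ViscSub G α lam u) (hl : lam ≤ mu) : ViscSub G α mu u :=
  ⟨h.1, fun φ hφ z hz => (h.2 φ hφ z hz).trans hl⟩

lemma cell_exists {n : ℕ} {F : Ham n} {C₃ C₄ C₅ : ℝ}
    (h1 : HypH1 F) (h2 : HypH2' F) (h3 : HypH3 F 0 C₃ C₄ C₅) (px : Euc n) (py K₀ : ℝ)
    (hK : ∀ x y t, |F x y t px py| ≤ K₀) : ∃ lam, CellOk F px py lam := by
  have hK₀ : 0 ≤ K₀ := (abs_nonneg _).trans (hK 0 0 0)
  have hcont : HCont (cellH F px py) := by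
    unfold HCont cellH
    exact h1.1.comp (f := fun ξ : Xi n =>
      ((ξ.1, ξ.2.1, ξ.2.2.1, px + ξ.2.2.2.1, py + ξ.2.2.2.2) : Xi n)) (by fun_prop)
  obtain ⟨C₁, C₂, hC₁, hC₂, hco⟩ := h2 (|py| + 1) (by positivity)
  have hF : ∀ x y t p, C₁ * ‖p‖ - C₂ ≤ F x y t p py := fun x y t p =>
    hco x y t p py (by linarith)
  have hαp : ∀ k : ℕ, 0 < 1 / ((k : ℝ) + 1) := fun k => by positivity
  choose w hwc hwp hws hwS hwN hwo using fun k : ℕ =>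
    disc_sol h1 h2 h3 px py (hαp k) hK
  set C := 1 + |py| + (K₀ + C₂ + C₁ * ‖px‖ + 1) * (√n / C₁ + 1) with hC
  have hαw : ∀ (k : ℕ) (z : Dom n), |1 / ((k : ℝ) + 1) * w k z| ≤ K₀ := by
    intro k z
    rw [abs_mul, abs_of_pos (hαp k)]
    calc _ ≤ 1 / ((k : ℝ) + 1) * (K₀ / (1 / ((k : ℝ) + 1))) := by
          gcongr; exact hwN k z
      _ = K₀ := by field_simp
  have hosc : ∀ k z, |w k z - w k 0| ≤ C := by
    intro k z
    have a1 := osc_bound hC₁ hC₂ hK₀ hF (hwc k) (hwp k) (hws k) (hαw k) (hwN k) (hwo k) z 0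
    have a2 := osc_bound hC₁ hC₂ hK₀ hF (hwc k) (hwp k) (hws k) (hαw k) (hwN k) (hwo k) 0 z
    rw [abs_le]; constructor <;> linarith
  obtain ⟨lam, -, ψ, hψ, hlim⟩ := isCompact_Icc.tendsto_subseq (s := Set.Icc (-K₀) K₀)
    (x := fun k : ℕ => -(1 / ((k : ℝ) + 1) * w k 0)) (by
      intro k
      have := abs_le.1 (hαw k 0)
      constructor <;> linarith)
  have hα0 : Tendsto (fun k => 1 / ((ψ k : ℝ) + 1) * C) atTop (𝓝 0) := by
    have := (tendsto_one_div_add_atTop_nhds_zero_nat (𝕜 := ℝ)).comp hψ.tendsto_atTop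
    simpa using this.mul_const C
  have hup := hlim.add hα0
  have hlo := hlim.sub hα0
  rw [add_zero] at hup
  rw [sub_zero] at hlo
  set u : ℕ → Dom n → ℝ := fun k z => w (ψ k) z - w (ψ k) 0 with hu
  have huC : ∀ k z, |u k z| ≤ C := fun k z => hosc (ψ k) z
  have hup' : ∀ k, STPeriodic (u k) := by
    intro k
    obtain ⟨a, b, c⟩ := hwp (ψ k)
    refine ⟨fun k x y t => ?_, fun x y t => ?_, fun x y t => ?_⟩
    · simp only [hu, a]
    · simp only [hu, b]
    · simp only [hu, c]
  refine ⟨lam, ⟨hls atTop u, ⟨C, hls_abs huC⟩, hls_periodic hup', ?_⟩, ?_⟩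
  · refine hls_sub hcont le_rfl huC fun ε hε => ?_
    filter_upwards [hup.eventually (gt_mem_nhds (show lam < lam + ε by linarith))] with k hk
    exact (fderiv_shift_const (hαp (ψ k)).le (hosc (ψ k)) (hws (ψ k))).mono_lam hk.le
  · have hnC : ∀ k z, |(fun z => - u k z) z| ≤ C := fun k z => by
      simpa using huC k z
    have hs : ViscSub (negH (cellH F px py)) 0 (-lam) (hls atTop (fun k z => - u k z)) := by
      refine hls_sub (negH_cont hcont) le_rfl hnC fun ε hε => ?_
      filter_upwards [hlo.eventually (lt_mem_nhds (show lam - ε < lam by linarith))] with k hk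
      refine (super_shift_const (hαp (ψ k)).le (hosc (ψ k)) (hwS (ψ k))).neg.mono_lam ?_
      simp only [Function.comp_apply] at hk
      linarith
    have hp : STPeriodic (hls atTop (fun k z => - u k z)) := by
      apply hls_periodic
      intro k
      obtain ⟨a, b, c⟩ := hup' k
      refine ⟨fun k x y t => ?_, fun x y t => ?_, fun x y t => ?_⟩
      · simp only [a]
      · simp only [b]
      · simp only [c]
    have hs2 := hs.neg
    rw [negH_negH, neg_neg] at hs2
    refine ⟨_, ⟨C, fun z => ?_⟩, ?_, hs2⟩
    · rw [abs_neg]; exact hls_abs hnC z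
    · obtain ⟨a, b, c⟩ := hp
      refine ⟨fun k x y t => ?_, fun x y t => ?_, fun x y t => ?_⟩
      · simp only [a]
      · simp only [b]
      · simp only [c]

/-- If F satisfies (H1), (H2') and (H3) with l = 0, then for every
(p_x,p_y) there is exactly one constant λ = F̄(p_x,p_y) such that the cell problem
`v_t + F(x,y,t,p_x + D_x v, p_y + D_y v) = λ` admits bounded space-time periodic usc
sub- and lsc supersolutions, and this constant satisfies
`min F(·,p_x,p_y) ≤ F̄(p_x,p_y) ≤ max F(·,p_x,p_y)`. -/
theorem statement14 {n : ℕ} (hn : 0 < n) (F : Ham n) (C₃ C₄ C₅ : ℝ)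
    (h1 : HypH1 F) (h2 : HypH2' F) (h3 : HypH3 F 0 C₃ C₄ C₅) :
    ∀ (px : Euc n) (py : ℝ),
      (∃! lam : ℝ, CellOk F px py lam) ∧
      (∀ lam : ℝ, CellOk F px py lam →
        sInf (Set.range fun z : Dom n => F z.1 z.2.1 z.2.2 px py) ≤ lam ∧
        lam ≤ sSup (Set.range fun z : Dom n => F z.1 z.2.1 z.2.2 px py)) := by
  intro px py
  have hgc : Continuous (fun z : Dom n => F z.1 z.2.1 z.2.2 px py) :=
    h1.1.comp (f := fun z : Dom n => ((z.1, z.2.1, z.2.2, px, py) : Xi n)) (by fun_prop)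
  obtain ⟨K₀, hK⟩ := per_bdd hgc
    ⟨fun k x y t => h1.2.1 k x y t px py, fun x y t => h1.2.2.1 x y t px py,
      fun x y t => h1.2.2.2 x y t px py⟩
  have hba : BddAbove (Set.range fun z : Dom n => F z.1 z.2.1 z.2.2 px py) :=
    ⟨K₀, by rintro _ ⟨z, rfl⟩; exact (abs_le.1 (hK z)).2⟩
  have hbb : BddBelow (Set.range fun z : Dom n => F z.1 z.2.1 z.2.2 px py) :=
    ⟨-K₀, by rintro _ ⟨z, rfl⟩; exact (abs_le.1 (hK z)).1⟩
  refine ⟨?_, ?_⟩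
  · obtain ⟨lam, hlam⟩ := cell_exists h1 h2 h3 px py K₀ (fun x y t => hK (x, y, t))
    refine ⟨lam, hlam, fun mu hmu => ?_⟩
    obtain ⟨⟨u, ub, up, us⟩, ⟨v, vb, vp, vs⟩⟩ := hlam
    obtain ⟨⟨u', ub', up', us'⟩, ⟨v', vb', vp', vs'⟩⟩ := hmu
    exact le_antisymm (cell_compare h1 h2 h3 us vs' ub vb' up vp')
      (cell_compare h1 h2 h3 us' vs ub' vb up' vp)
  · rintro lam ⟨⟨u, ub, up, us⟩, ⟨v, vb, vp, vs⟩⟩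
    constructor
    · exact cell_compare h1 h2 h3 us (cell_zero_super fun x y t => csInf_le hbb ⟨(x, y, t), rfl⟩)
        ub zero_bdd up zero_periodic
    · exact cell_compare h1 h2 h3 (cell_zero_sub fun x y t => le_csSup hba ⟨(x, y, t), rfl⟩) vs
        zero_bdd vb zero_periodic vp
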